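/- Let Ω ⊂ ℝ^N be a uniformly smooth domain and u a bounded solution of the Dirichlet problem Pu = f in Ω × ℝ, u = g on ∂Ω × ℝ, where P, f, g are periodic in the m-th variable with the same period l_m (and Ω is periodic in the direction x_m if m ≠ N+1), and c ≤ 0. Then u is periodic in the m-th variable with period l_m. -/

import Mathlib

open Filter Topology

noncomputable section

/-- Euclidean `N`-space. -/
abbrev EN (N : ℕ) := EuclideanSpace ℝ (Fin N)

/-- First-order spatial partial derivative in the direction `i`. -/
def pdE {N : ℕ} (i : Fin N) (φ : EN N → ℝ) (x : EN N) : ℝ :=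
  fderiv ℝ φ x (EuclideanSpace.single i 1)

/-- Second-order spatial partial derivative `∂ᵢⱼ`. -/
def pdE2 {N : ℕ} (i j : Fin N) (φ : EN N → ℝ) (x : EN N) : ℝ :=
  pdE i (fun y => pdE j φ y) x

/-- The parabolic operator `P u = ∂ₜ u − aᵢⱼ ∂ᵢⱼ u − bᵢ ∂ᵢ u − c u`. -/
def parOpE {N : ℕ} (a : Fin N → Fin N → EN N → ℝ → ℝ)
    (b : Fin N → EN N → ℝ → ℝ) (c : EN N → ℝ → ℝ)
    (u : EN N → ℝ → ℝ) (x : EN N) (t : ℝ) : ℝ :=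
  deriv (fun s => u x s) t
    - (∑ i, ∑ j, a i j x t * pdE2 i j (fun y => u y t) x)
    - (∑ i, b i x t * pdE i (fun y => u y t) x)
    - c x t * u x t

/-- Bounded on `Ω × ℝ`. -/
def BddOn {N : ℕ} (Ω : Set (EN N)) (φ : EN N → ℝ → ℝ) : Prop :=
  ∃ M : ℝ, ∀ x ∈ Ω, ∀ t : ℝ, |φ x t| ≤ M

/-- Uniformly continuous on `Ω × ℝ`. -/
def UCOn {N : ℕ} (Ω : Set (EN N)) (φ : EN N → ℝ → ℝ) : Prop :=
  UniformContinuousOn (fun p : EN N × ℝ => φ p.1 p.2) (Ω ×ˢ Set.univ)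

/-- Standing assumptions on the coefficients of `P` on the domain `Ω`. -/
def StdCoeffsOn {N : ℕ} (Ω : Set (EN N)) (a : Fin N → Fin N → EN N → ℝ → ℝ)
    (b : Fin N → EN N → ℝ → ℝ) (c : EN N → ℝ → ℝ) : Prop :=
  (∀ i j, BddOn Ω (a i j)) ∧ (∀ i j, UCOn Ω (a i j)) ∧
  (∀ i, BddOn Ω (b i)) ∧ (∀ i, UCOn Ω (b i)) ∧
  BddOn Ω c ∧ Measurable (fun p : EN N × ℝ => c p.1 p.2) ∧
  (∀ i j, ∀ x ∈ Ω, ∀ t : ℝ, a i j x t = a j i x t) ∧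
  (∃ a₀ a₁ : ℝ, 0 < a₀ ∧ a₀ ≤ a₁ ∧ ∀ x ∈ Ω, ∀ (t : ℝ) (ξ : EN N),
    a₀ * ∑ i, ξ i ^ 2 ≤ ∑ i, ∑ j, a i j x t * ξ i * ξ j ∧
    ∑ i, ∑ j, a i j x t * ξ i * ξ j ≤ a₁ * ∑ i, ξ i ^ 2)

/-- Regularity required of solutions on `Ω × ℝ`: continuity up to the boundary and
classical differentiability inside. -/
def RegSolOn {N : ℕ} (Ω : Set (EN N)) (u : EN N → ℝ → ℝ) : Prop :=
  ContinuousOn (fun p : EN N × ℝ => u p.1 p.2) (closure Ω ×ˢ Set.univ) ∧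
  (∀ x ∈ Ω, Differentiable ℝ fun s => u x s) ∧
  (∀ t : ℝ, ∀ x ∈ Ω, ContDiffAt ℝ 2 (fun y => u y t) x)

/-- `u` is a solution of the Dirichlet problem `P u = f` in `Ω × ℝ`, `u = g` on
`∂Ω × ℝ`. -/
def IsSolDir {N : ℕ} (Ω : Set (EN N)) (a : Fin N → Fin N → EN N → ℝ → ℝ)
    (b : Fin N → EN N → ℝ → ℝ) (c : EN N → ℝ → ℝ)
    (f g u : EN N → ℝ → ℝ) : Prop :=
  RegSolOn Ω u ∧ (∀ x ∈ Ω, ∀ t : ℝ, parOpE a b c u x t = f x t) ∧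
  (∀ x ∈ frontier Ω, ∀ t : ℝ, u x t = g x t)

/-- Periodicity, with period `l`, in the `m`-th space-time variable, for points of
the set `S`. -/
def PerInVarS {N : ℕ} (S : Set (EN N)) (m : Fin (N + 1)) (l : ℝ)
    (φ : EN N → ℝ → ℝ) : Prop :=
  if h : (m : ℕ) < N then
    ∀ x ∈ S, ∀ t : ℝ, φ (x + EuclideanSpace.single (⟨(m : ℕ), h⟩ : Fin N) l) t = φ x t
  else ∀ x ∈ S, ∀ t : ℝ, φ x (t + l) = φ x t

/-- A proxy for the uniform smoothness of the domain `Ω`: `Ω` is open and satisfies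
a uniform two-sided ball condition at its boundary. -/
def UniformlySmooth {N : ℕ} (Ω : Set (EN N)) : Prop :=
  IsOpen Ω ∧ ∃ r : ℝ, 0 < r ∧ ∀ p ∈ frontier Ω,
    (∃ y : EN N, Metric.ball y r ⊆ Ω ∧ dist p y = r) ∧
    (∃ y : EN N, Metric.ball y r ⊆ Ωᶜ ∧ dist p y = r)

lemma aux_second {G G' : ℝ → ℝ} {G2 : ℝ} (h1 : ∀ᶠ s in 𝓝 (0:ℝ), HasDerivAt G (G' s) s)
    (h2 : HasDerivAt G' G2 0) (hmax : ∀ᶠ s in 𝓝 (0:ℝ), G s ≤ G 0) : G' 0 = 0 ∧ G2 ≤ 0 := by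
  have hm : IsLocalMax G 0 := hmax
  have h0 : HasDerivAt G (G' 0) 0 := h1.self_of_nhds
  have e0 : G' 0 = 0 := hm.hasDerivAt_eq_zero h0
  refine ⟨e0, ?_⟩
  by_contra hcon
  push Not at hcon
  have hd : deriv G =ᶠ[𝓝 0] G' := h1.mono fun s hs => hs.deriv
  have hdd : HasDerivAt (deriv G) G2 0 := h2.congr_of_eventuallyEq hd
  have hmin : IsLocalMin G 0 := by
    apply isLocalMin_of_deriv_deriv_pos
    · rw [hdd.deriv]; exact hcon
    · rw [h0.deriv, e0]
    · exact h0.continuousAt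
  have hc : G =ᶠ[𝓝 0] fun _ => G 0 := by
    filter_upwards [hmax, hmin] with s hs hs'
    exact le_antisymm hs hs'
  have hc2 : deriv G =ᶠ[𝓝 0] fun _ => 0 := by
    have := hc.deriv
    simpa using this
  have : G2 = 0 := by
    have h3 : HasDerivAt (deriv G) 0 0 := (hasDerivAt_const (0:ℝ) (0:ℝ)).congr_of_eventuallyEq hc2
    exact hdd.unique h3
  linarith

lemma aux_left {G : ℝ → ℝ} {G1 t : ℝ} (h1 : HasDerivAt G G1 t)
    (hmax : ∀ᶠ r in 𝓝[<] t, G r ≤ G t) : 0 ≤ G1 := by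
  have h2 := (hasDerivAt_iff_tendsto_slope_left_right.1 h1).1
  refine ge_of_tendsto h2 ?_
  filter_upwards [hmax, self_mem_nhdsWithin] with r hr hr2
  rw [slope_def_field]
  apply div_nonneg_of_nonpos
  · linarith
  · have : r < t := hr2
    linarith

open scoped MatrixOrder in
lemma aux_psd {N : ℕ} (A : Matrix (Fin N) (Fin N) ℝ) (hP : A.PosSemidef) :
    ∃ B : Matrix (Fin N) (Fin N) ℝ, A = star B * B :=
  CStarAlgebra.nonneg_iff_eq_star_mul_self.1 hP.nonneg

lemma aux_trace {N : ℕ} (A Q : Fin N → Fin N → ℝ) (hs : ∀ i j, A i j = A j i)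
    (hA : ∀ ξ : Fin N → ℝ, 0 ≤ ∑ i, ∑ j, A i j * ξ i * ξ j)
    (hQ : ∀ ξ : Fin N → ℝ, ∑ i, ∑ j, Q i j * ξ i * ξ j ≤ 0) :
    ∑ i, ∑ j, A i j * Q i j ≤ 0 := by
  have hP : (Matrix.of A).PosSemidef := by
    refine Matrix.PosSemidef.of_dotProduct_mulVec_nonneg ?_ ?_
    · ext i j; simp [hs j i]
    · intro x
      refine (hA x).trans_eq ?_
      simp only [dotProduct, Matrix.mulVec, Matrix.of_apply, Finset.mul_sum, star_trivial]
      refine Finset.sum_congr rfl fun i _ => Finset.sum_congr rfl fun j _ => by ring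
  obtain ⟨B, hB⟩ := aux_psd _ hP
  have hAe : ∀ i j, A i j = ∑ k, B k i * B k j := by
    intro i j
    have := congrFun (congrFun hB i) j
    simpa [Matrix.mul_apply, Matrix.star_eq_conjTranspose] using this
  have : ∑ i, ∑ j, A i j * Q i j = ∑ k, ∑ i, ∑ j, Q i j * B k i * B k j := by
    simp_rw [hAe, Finset.sum_mul]
    rw [Finset.sum_comm' (t' := Finset.univ) (s' := fun _ => Finset.univ) (by simp)]
    rw [Finset.sum_congr rfl fun j _ => Finset.sum_comm]
    rw [Finset.sum_comm]
    refine Finset.sum_congr rfl fun k _ => ?_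
    rw [Finset.sum_comm]
    refine Finset.sum_congr rfl fun i _ => Finset.sum_congr rfl fun j _ => by ring
  rw [this]
  exact Finset.sum_nonpos fun k _ => hQ (B k)

lemma aux_line {N : ℕ} (φ : EN N → ℝ) (x ξ : EN N) (h : ContDiffAt ℝ 2 φ x) :
    ∃ G' : ℝ → ℝ, (∀ᶠ s in 𝓝 (0:ℝ), HasDerivAt (fun s : ℝ => φ (x + s • ξ)) (G' s) s) ∧
      HasDerivAt G' (∑ i, ∑ j, pdE2 i j φ x * ξ i * ξ j) 0 ∧
      G' 0 = ∑ i, pdE i φ x * ξ i := by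
  have hexp : ∀ ξ : EN N, ξ = ∑ i, ξ i • (EuclideanSpace.single i (1:ℝ) : EN N) := by
    intro ξ
    have := (EuclideanSpace.basisFun (Fin N) ℝ).sum_repr ξ
    simpa using this.symm
  have hev : ∀ᶠ y in 𝓝 x, DifferentiableAt ℝ φ y := by
    filter_upwards [h.eventually (by simp)] with y hy
    exact hy.differentiableAt (by simp)
  have hd2 : DifferentiableAt ℝ (fderiv ℝ φ) x :=
    (h.fderiv_right (m := 1) (by norm_num)).differentiableAt (by simp)
  have hl : ∀ s : ℝ, HasDerivAt (fun s : ℝ => x + s • ξ) ξ s := by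
    intro s
    simpa using ((hasDerivAt_id s).smul_const ξ).const_add x
  have ht : Tendsto (fun s : ℝ => x + s • ξ) (𝓝 0) (𝓝 x) := by
    have := (hl 0).continuousAt.tendsto
    simpa using this
  refine ⟨fun s => fderiv ℝ φ (x + s • ξ) ξ, ?_, ?_, ?_⟩
  · filter_upwards [ht.eventually hev] with s hs
    exact hs.hasFDerivAt.comp_hasDerivAt s (hl s)
  · have hd2' : HasFDerivAt (fderiv ℝ φ) (fderiv ℝ (fderiv ℝ φ) x) (x + (0:ℝ) • ξ) := by
      simpa using hd2.hasFDerivAt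
    have h1 := hd2'.comp_hasDerivAt (0:ℝ) (hl 0)
    have h2 := h1.clm_apply (hasDerivAt_const (0:ℝ) ξ)
    suffices hsuf : ∑ i, ∑ j, pdE2 i j φ x * ξ i * ξ j = fderiv ℝ (fderiv ℝ φ) x ξ ξ by
      rw [hsuf]
      rw [map_zero, add_zero] at h2
      exact h2
    have hp : ∀ i j, pdE2 i j φ x = fderiv ℝ (fderiv ℝ φ) x (EuclideanSpace.single i 1)
        (EuclideanSpace.single j 1) := by
      intro i j
      unfold pdE2 pdE
      have := hd2.hasFDerivAt.clm_apply (hasFDerivAt_const (EuclideanSpace.single j (1:ℝ) : EN N) x)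
      rw [this.fderiv]
      simp
    simp_rw [hp]
    conv_rhs => rw [hexp ξ]
    simp only [map_sum, map_smul, _root_.sum_apply, _root_.smul_apply,
      smul_eq_mul, Finset.mul_sum]
    rw [Finset.sum_comm]
    refine Finset.sum_congr rfl fun i _ => Finset.sum_congr rfl fun j _ => by ring
  · simp only [zero_smul, add_zero]
    conv_lhs => rw [hexp ξ]
    simp only [map_sum, map_smul, smul_eq_mul, pdE]
    refine Finset.sum_congr rfl fun i _ => by ring

lemma aux_algebra {N : ℕ} (ax ay X Y : Fin N → Fin N → ℝ) (h : Fin N → ℝ)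
    (a0 Ab ε r2 β0 β1 β2 : ℝ) (hr2 : ∑ i, h i ^ 2 = r2) (hr2p : 0 < r2)
    (hβ0 : 0 ≤ β0) (hβ1 : 0 ≤ β1) (hβ2 : β2 ≤ 0) (ha0 : 0 < a0)
    (hε : ε = a0 / (12 * (N + 1)))
    (hsx : ∀ i j, ax i j = ax j i) (hsy : ∀ i j, ay i j = ay j i)
    (hell : ∀ ξ : Fin N → ℝ, a0 * ∑ i, ξ i ^ 2 ≤ ∑ i, ∑ j, ax i j * ξ i * ξ j)
    (hAb : ∀ i j, |ax i j| ≤ Ab)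
    (hclose : ∀ i j, |ax i j - ay i j| ≤ ε / (N + 1))
    (hQ : ∀ ξ η : Fin N → ℝ, ∑ i, ∑ j, X i j * ξ i * ξ j - ∑ i, ∑ j, Y i j * η i * η j ≤
      β2 * (∑ i, h i * (ξ i - η i)) ^ 2 + β1 * ∑ i, (ξ i - η i) ^ 2 + β0 * ∑ i, ξ i ^ 2) :
    ∑ i, ∑ j, ax i j * X i j - ∑ i, ∑ j, ay i j * Y i j ≤
      a0 / 2 * (4 * β2 * r2 + 4 * β1 + β0) + 3 * N * ε * β1 + β0 * (N * Ab + N * ε) := by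
  have hNp : (0:ℝ) < N + 1 := by positivity
  have hN0 : (0:ℝ) ≤ N := by positivity
  have hεp : 0 < ε := by rw [hε]; positivity
  have hεle : ε ≤ a0 / 2 := by
    rw [hε, div_le_div_iff₀ (by positivity) (by positivity)]; nlinarith
  have hdiag : ∀ (f : Fin N → ℝ) (k : ℝ),
      ∑ i, ∑ j, (if i = j then k else 0) * f i * f j = k * ∑ i, f i ^ 2 := by
    intro f k
    simp only [ite_mul, zero_mul, Finset.sum_ite_eq, Finset.mem_univ, if_true, Finset.mul_sum]
    refine Finset.sum_congr rfl fun i _ => by ring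
  have hdiag2 : ∀ (f : Fin N → Fin N → ℝ) (k : ℝ),
      ∑ i, ∑ j, (if i = j then k else 0) * f i j = k * ∑ i, f i i := by
    intro f k
    simp only [ite_mul, zero_mul, Finset.sum_ite_eq, Finset.mem_univ, if_true, Finset.mul_sum]
  have hrank : ∀ (f : Fin N → ℝ),
      ∑ i, ∑ j, (h i * h j) * f i * f j = (∑ i, h i * f i) ^ 2 := by
    intro f
    rw [sq, Finset.sum_mul_sum]
    refine Finset.sum_congr rfl fun i _ => Finset.sum_congr rfl fun j _ => by ring
  have hCS : ∀ f : Fin N → ℝ, (∑ i, h i * f i) ^ 2 ≤ r2 * ∑ i, f i ^ 2 := by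
    intro f; rw [← hr2]; exact Finset.sum_mul_sq_le_sq_mul_sq _ _ _
  set θ := a0 / 2 / r2 with hθ
  have hθr : θ * r2 = a0 / 2 := by rw [hθ]; field_simp
  have hθp : 0 < θ := by rw [hθ]; positivity
  -- shared part
  have h1 := aux_trace (fun i j => ax i j - θ * (h i * h j) - (if i = j then ε else 0))
    (fun i j => X i j - Y i j - (if i = j then β0 else 0))
    (by intro i j; simp only [hsx i j, eq_comm (a := i), mul_comm (h i)])
    (by
      intro ξ
      have e : ∑ i, ∑ j, (ax i j - θ * (h i * h j) - (if i = j then ε else 0)) * ξ i * ξ j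
        = ∑ i, ∑ j, ax i j * ξ i * ξ j - θ * (∑ i, h i * ξ i) ^ 2 - ε * ∑ i, ξ i ^ 2 := by
        rw [← hrank, ← hdiag]
        simp only [Finset.mul_sum, ← Finset.sum_sub_distrib]
        refine Finset.sum_congr rfl fun i _ => Finset.sum_congr rfl fun j _ => by ring
      rw [e]
      have := hell ξ
      have h3 := mul_le_mul_of_nonneg_left (hCS ξ) hθp.le
      rw [← mul_assoc, hθr] at h3
      have h4 : 0 ≤ ∑ i, ξ i ^ 2 := Finset.sum_nonneg fun i _ => sq_nonneg _
      nlinarith)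
    (by
      intro ξ
      have e : ∑ i, ∑ j, (X i j - Y i j - (if i = j then β0 else 0)) * ξ i * ξ j
        = ∑ i, ∑ j, X i j * ξ i * ξ j - ∑ i, ∑ j, Y i j * ξ i * ξ j - β0 * ∑ i, ξ i ^ 2 := by
        rw [← hdiag]
        simp only [← Finset.sum_sub_distrib]
        refine Finset.sum_congr rfl fun i _ => Finset.sum_congr rfl fun j _ => by ring
      rw [e]
      have := hQ ξ ξ
      simp at this
      linarith)
  -- remainder y part
  have h2 := aux_trace (fun i j => (if i = j then ε else 0) + (ay i j - ax i j))
    (fun i j => - Y i j - (if i = j then β1 else 0))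
    (by intro i j; simp only [hsx i j, hsy i j, eq_comm (a := i)])
    (by
      intro ξ
      have e : ∑ i, ∑ j, ((if i = j then ε else 0) + (ay i j - ax i j)) * ξ i * ξ j
        = ε * ∑ i, ξ i ^ 2 + ∑ i, ∑ j, (ay i j - ax i j) * ξ i * ξ j := by
        rw [← hdiag]
        simp only [← Finset.sum_add_distrib]
        refine Finset.sum_congr rfl fun i _ => Finset.sum_congr rfl fun j _ => by ring
      rw [e]
      have h3 : - (ε / (N + 1) * (∑ i, |ξ i|) ^ 2) ≤ ∑ i, ∑ j, (ay i j - ax i j) * ξ i * ξ j := by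
        rw [sq, Finset.sum_mul_sum]
        simp only [Finset.mul_sum, ← Finset.sum_neg_distrib]
        refine Finset.sum_le_sum fun i _ => Finset.sum_le_sum fun j _ => ?_
        rw [neg_le]
        calc -((ay i j - ax i j) * ξ i * ξ j) = (ax i j - ay i j) * (ξ i * ξ j) := by ring
          _ ≤ |(ax i j - ay i j) * (ξ i * ξ j)| := le_abs_self _
          _ = |ax i j - ay i j| * (|ξ i| * |ξ j|) := by rw [abs_mul, abs_mul]
          _ ≤ _ := mul_le_mul_of_nonneg_right (hclose i j) (by positivity)
      have h4 : (∑ i, |ξ i|) ^ 2 ≤ N * ∑ i, ξ i ^ 2 := by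
        have := sq_sum_le_card_mul_sum_sq (s := (Finset.univ : Finset (Fin N))) (f := fun i => |ξ i|)
        simpa using this
      have h5 : 0 ≤ ∑ i, ξ i ^ 2 := Finset.sum_nonneg fun i _ => sq_nonneg _
      have h6 : ε / (N + 1) * (∑ i, |ξ i|) ^ 2 ≤ ε * ∑ i, ξ i ^ 2 := by
        calc ε / (N + 1) * (∑ i, |ξ i|) ^ 2 ≤ ε / (N + 1) * ((N + 1) * ∑ i, ξ i ^ 2) := by
              apply mul_le_mul_of_nonneg_left _ (by positivity); linarith
          _ = _ := by field_simp
      linarith)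
    (by
      intro ξ
      have e : ∑ i, ∑ j, (- Y i j - (if i = j then β1 else 0)) * ξ i * ξ j
        = - ∑ i, ∑ j, Y i j * ξ i * ξ j - β1 * ∑ i, ξ i ^ 2 := by
        rw [← hdiag]
        simp only [← Finset.sum_sub_distrib, ← Finset.sum_neg_distrib]
        refine Finset.sum_congr rfl fun i _ => Finset.sum_congr rfl fun j _ => by ring
      rw [e]
      have := hQ 0 ξ
      simp at this
      nlinarith [sq_nonneg (∑ i, h i * ξ i)])
  -- mirror part
  have h3 := hQ h (-h)
  have e3 : ∑ i, h i * (h i - (-h) i) = 2 * r2 := by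
    rw [← hr2, Finset.mul_sum]
    refine Finset.sum_congr rfl fun i _ => by simp; ring
  have e3' : ∑ i, (h i - (-h) i) ^ 2 = 4 * r2 := by
    rw [← hr2, Finset.mul_sum]
    refine Finset.sum_congr rfl fun i _ => by simp; ring
  rw [e3, e3', hr2] at h3
  simp only [Pi.neg_apply, mul_neg, neg_mul, neg_neg] at h3
  -- remainder x part
  have h4 : ∑ i, X i i ≤ N * (β1 + β0) := by
    have : ∀ i ∈ (Finset.univ : Finset (Fin N)), X i i ≤ β1 + β0 := by
      intro i _
      have := hQ (Pi.single i 1) 0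
      simp [Pi.single_apply] at this
      nlinarith [sq_nonneg (h i)]
    simpa [mul_add] using Finset.sum_le_sum this
  have e1 : ∑ i, ∑ j, (ax i j - θ * (h i * h j) - (if i = j then ε else 0)) *
      (X i j - Y i j - (if i = j then β0 else 0)) =
      ∑ i, ∑ j, ax i j * X i j - ∑ i, ∑ j, ax i j * Y i j - β0 * ∑ i, ax i i
      - θ * (∑ i, ∑ j, X i j * h i * h j - ∑ i, ∑ j, Y i j * h i * h j) + θ * β0 * r2
      - ε * ∑ i, X i i + ε * ∑ i, Y i i + N * (ε * β0) := by
    rw [← hdiag2, ← hdiag2, ← hdiag2, ← hr2]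
    have : θ * β0 * ∑ i, h i ^ 2 = ∑ i, ∑ j, (if i = j then θ * β0 else 0) * (h i * h j) := by
      rw [hdiag2]; simp_rw [sq]
    rw [this]
    have : (N:ℝ) * (ε * β0) = ∑ i : Fin N, ∑ j : Fin N, (if i = j then ε * β0 else 0) * 1 := by
      rw [hdiag2 (fun _ _ => 1)]; simp; ring
    rw [this]
    simp only [Finset.mul_sum, ← Finset.sum_sub_distrib, ← Finset.sum_add_distrib]
    refine Finset.sum_congr rfl fun i _ => Finset.sum_congr rfl fun j _ => ?_
    split_ifs <;> ring
  have e2 : ∑ i, ∑ j, ((if i = j then ε else 0) + (ay i j - ax i j)) *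
      (- Y i j - (if i = j then β1 else 0)) =
      - ε * ∑ i, Y i i - N * (ε * β1) - ∑ i, ∑ j, ay i j * Y i j + ∑ i, ∑ j, ax i j * Y i j
      - β1 * ∑ i, (ay i i - ax i i) := by
    rw [← hdiag2 Y, ← hdiag2 (fun i j => ay i j - ax i j)]
    have : (N:ℝ) * (ε * β1) = ∑ i : Fin N, ∑ j : Fin N, (if i = j then ε * β1 else 0) * 1 := by
      rw [hdiag2 (fun _ _ => 1)]; simp; ring
    rw [this]
    simp only [← Finset.sum_sub_distrib, ← Finset.sum_add_distrib]
    refine Finset.sum_congr rfl fun i _ => Finset.sum_congr rfl fun j _ => ?_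
    split_ifs <;> ring
  rw [e1] at h1
  rw [e2] at h2
  have h5 : ∑ i, ax i i ≤ N * Ab := by
    have : ∀ i ∈ (Finset.univ : Finset (Fin N)), ax i i ≤ Ab := fun i _ =>
      (le_abs_self _).trans (hAb i i)
    simpa using Finset.sum_le_sum this
  have h6 : ∑ i, (ay i i - ax i i) ≤ N * ε := by
    have : ∀ i ∈ (Finset.univ : Finset (Fin N)), ay i i - ax i i ≤ ε := fun i _ => by
      have h7 := (abs_le.1 (hclose i i)).1
      have : ε / (N + 1) ≤ ε := div_le_self hεp.le (by linarith)
      linarith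
    simpa using Finset.sum_le_sum this
  have h7 := mul_le_mul_of_nonneg_left h3 hθp.le
  have e7 : θ * (β2 * (2 * r2) ^ 2 + β1 * (4 * r2) + β0 * r2) =
      a0 / 2 * (4 * β2 * r2 + 4 * β1 + β0) := by
    rw [← hθr]; ring
  rw [e7] at h7
  have h8 := mul_le_mul_of_nonneg_left h4 hεp.le
  have h9 := mul_le_mul_of_nonneg_left h5 hβ0
  have h10 := mul_le_mul_of_nonneg_left h6 hβ1
  have h11 : 0 ≤ θ * β0 * r2 := by positivity
  have h12 : 0 ≤ N * (ε * β0) := by positivity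
  linarith

/-- Bounded-coefficient zero solutions with zero boundary data. -/
structure ZSol {N : ℕ} (Ω : Set (EN N)) (a : Fin N → Fin N → EN N → ℝ → ℝ)
    (b : Fin N → EN N → ℝ → ℝ) (c : EN N → ℝ → ℝ) (v : EN N → ℝ → ℝ) : Prop where
  op : IsOpen Ω
  cont : ContinuousOn (fun p : EN N × ℝ => v p.1 p.2) (closure Ω ×ˢ Set.univ)
  dt : ∀ x ∈ Ω, Differentiable ℝ fun s => v x s
  c2 : ∀ t : ℝ, ∀ x ∈ Ω, ContDiffAt ℝ 2 (fun y => v y t) x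
  eqn : ∀ x ∈ Ω, ∀ t : ℝ, parOpE a b c v x t = 0
  bd : ∀ x ∈ frontier Ω, ∀ t : ℝ, v x t = 0

lemma aux_inner {N : ℕ} (x y : EN N) : inner ℝ x y = ∑ i, x i * y i := by
  simp [PiLp.inner_apply, mul_comm]

lemma aux_nsq {N : ℕ} (x : EN N) : ‖x‖ ^ 2 = ∑ i, x i ^ 2 := by
  simp [EuclideanSpace.norm_sq_eq]

lemma aux_exp {N : ℕ} (g ξ : EN N) (s : ℝ) :
    ‖g + s • ξ‖ ^ 2 = ‖g‖ ^ 2 + 2 * s * inner ℝ g ξ + s ^ 2 * ‖ξ‖ ^ 2 := by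
  rw [norm_add_sq_real, inner_smul_right, norm_smul, mul_pow, Real.norm_eq_abs, sq_abs]; ring

lemma aux_quadpoly (A B C s : ℝ) :
    HasDerivAt (fun s : ℝ => A + 2 * s * B + s ^ 2 * C) (2 * B + 2 * s * C) s := by
  have h1 := (((hasDerivAt_id s).const_mul 2).mul_const B).const_add A
  have h2 := ((hasDerivAt_id s).pow 2).mul_const C
  refine (h1.add h2).congr_deriv ?_
  simp

lemma aux_sum_abs {N : ℕ} (b : Fin N → ℝ) (g : EN N) (Bb ρ : ℝ) (hb : ∀ i, |b i| ≤ Bb)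
    (hg : ‖g‖ ≤ ρ) : |∑ i, b i * g i| ≤ N * (Bb * ρ) := by
  have : ∀ i ∈ (Finset.univ : Finset (Fin N)), |b i * g i| ≤ Bb * ρ := by
    intro i _
    rw [abs_mul]
    have h1 : |g i| ≤ ρ := by
      have := PiLp.norm_apply_le g i
      rw [Real.norm_eq_abs] at this
      exact this.trans hg
    exact mul_le_mul (hb i) h1 (abs_nonneg _) ((abs_nonneg _).trans (hb i))
  refine (Finset.abs_sum_le_sum_abs _ _).trans ?_
  simpa using Finset.sum_le_sum this

lemma aux_quad_pos (L q E P : ℝ) (hP : 0 < P) (hPL : P * L = E ^ 2) :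
    0 < L * q ^ 2 - E * q + P := by
  have h : P * (L * q ^ 2 - E * q + P) = (E * q - P / 2) ^ 2 + 3 / 4 * P ^ 2 := by
    rw [mul_add, mul_sub, ← mul_assoc, hPL]; ring
  have h2 : 0 < P * (L * q ^ 2 - E * q + P) := by rw [h]; positivity
  exact pos_of_mul_pos_right h2 hP.le

set_option maxHeartbeats 1000000 in
lemma aux_tube {N : ℕ} {Ω : Set (EN N)} {a : Fin N → Fin N → EN N → ℝ → ℝ}
    {b : Fin N → EN N → ℝ → ℝ} {c : EN N → ℝ → ℝ} {v : EN N → ℝ → ℝ}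
    (hz : ZSol Ω a b c v) (hc : ∀ x ∈ Ω, ∀ t : ℝ, c x t ≤ 0)
    (hsym : ∀ i j, ∀ x ∈ Ω, ∀ t : ℝ, a i j x t = a j i x t)
    (a0 Ab Bb : ℝ) (ha0 : 0 < a0)
    (hell : ∀ x ∈ Ω, ∀ (t : ℝ) (ξ : EN N), a0 * ∑ i, ξ i ^ 2 ≤ ∑ i, ∑ j, a i j x t * ξ i * ξ j)
    (hAb0 : 0 ≤ Ab) (hBb0 : 0 ≤ Bb)
    (hAb : ∀ i j, ∀ x ∈ Ω, ∀ t : ℝ, |a i j x t| ≤ Ab)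
    (hBb : ∀ i, ∀ x ∈ Ω, ∀ t : ℝ, |b i x t| ≤ Bb)
    (S : ℝ) (hS : ∀ x ∈ closure Ω, ∀ t : ℝ, v x t ≤ S)
    (K ρ D δ : ℝ) (hK : 0 ≤ K) (hρ : 0 < ρ) (hδ : 0 < δ) (hδS : δ ≤ S) :
    ∃ κ : ℝ, 0 < κ ∧ ∀ (y : EN N) (s : ℝ) (x0 : EN N) (t0 : ℝ), x0 ∈ closure Ω → s + 1 ≤ t0 →
      t0 ≤ s + D → ‖x0 - y‖ ≤ K → (∀ x ∈ Ω, ‖x - y‖ < ρ → v x s ≤ S - δ) →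
      v x0 t0 ≤ S - κ := by
  set C2 : ℝ := 4 * (ρ * K + N * Ab + N * (Bb * ρ)) with hC2
  set L : ℝ := (C2 + 8 * a0) ^ 2 / (8 * a0 * ρ ^ 2) with hL
  have hL0 : 0 ≤ L := by rw [hL]; positivity
  refine ⟨δ * Real.exp (-(L * D)), by positivity, ?_⟩
  intro y s x0 t0 hx0 hst hD hKd hini
  set d : ℝ := t0 - s with hd
  have hd1 : 1 ≤ d := by linarith
  set η : EN N := (1 / d) • (x0 - y) with hη
  have hηK : ‖η‖ ≤ K := by
    rw [hη, norm_smul, Real.norm_eq_abs, abs_of_pos (by positivity)]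
    have : 1 / d ≤ 1 := by rw [div_le_one (by linarith)]; exact hd1
    calc 1 / d * ‖x0 - y‖ ≤ 1 * ‖x0 - y‖ := mul_le_mul_of_nonneg_right this (norm_nonneg _)
      _ ≤ K := by linarith
  set z : ℝ → EN N := fun t => y + (t - s) • η with hzdef
  have hzs : z s = y := by simp [hzdef]
  have hzt0 : z t0 = x0 := by
    simp only [hzdef, hη, smul_smul]
    rw [← hd, mul_one_div_cancel (by linarith)]; simp
  set φ : EN N → ℝ → ℝ := fun x t =>
    δ / ρ ^ 4 * (ρ ^ 2 - ‖x - z t‖ ^ 2) ^ 2 * Real.exp (-(L * (t - s))) with hφ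
  have hzc : Continuous z := by fun_prop
  have hφc : Continuous (fun p : EN N × ℝ => φ p.1 p.2) := by
    simp only [hφ]; fun_prop
  have hφle : ∀ x t, s ≤ t → ‖x - z t‖ ≤ ρ → φ x t ≤ δ := by
    intro x t hst' hx
    have h1 : Real.exp (-(L * (t - s))) ≤ 1 := by
      rw [Real.exp_le_one_iff]
      have : 0 ≤ L * (t - s) := mul_nonneg hL0 (by linarith)
      linarith
    have h3 : ‖x - z t‖ ^ 2 ≤ ρ ^ 2 := pow_le_pow_left₀ (norm_nonneg _) hx 2
    have h2 : (ρ ^ 2 - ‖x - z t‖ ^ 2) ^ 2 ≤ (ρ ^ 2) ^ 2 :=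
      pow_le_pow_left₀ (by linarith) (by linarith [sq_nonneg ‖x - z t‖]) 2
    calc φ x t ≤ δ / ρ ^ 4 * (ρ ^ 2) ^ 2 * 1 := by
          simp only [hφ]; gcongr
      _ = δ := by field_simp
  set Ks : Set (EN N × ℝ) := {p | p.1 ∈ closure Ω ∧ s ≤ p.2 ∧ p.2 ≤ t0 ∧ ‖p.1 - z p.2‖ ≤ ρ} with hKs
  have hKsc : IsCompact Ks := by
    refine IsCompact.of_isClosed_subset
      ((isCompact_closedBall y (ρ + K * d)).prod (isCompact_Icc (a := s) (b := t0))) ?_ ?_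
    · have e : Ks = ((fun p : EN N × ℝ => p.1) ⁻¹' (closure Ω)) ∩ {p | s ≤ p.2} ∩ {p | p.2 ≤ t0} ∩
        {p | ‖p.1 - z p.2‖ ≤ ρ} := by
        ext p; simp [hKs, and_assoc]
      rw [e]
      refine (((isClosed_closure.preimage continuous_fst).inter ?_).inter ?_).inter ?_
      · exact isClosed_le continuous_const continuous_snd
      · exact isClosed_le continuous_snd continuous_const
      · exact isClosed_le (by fun_prop) continuous_const
    · rintro ⟨x, t⟩ ⟨_, h2, h3, h4⟩
      refine ⟨?_, h2, h3⟩
      simp only at h2 h3 h4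
      simp only [Metric.mem_closedBall, dist_eq_norm]
      have : x - y = (x - z t) + (t - s) • η := by simp only [hzdef]; abel
      rw [this]
      refine (norm_add_le _ _).trans (add_le_add h4 ?_)
      rw [norm_smul, Real.norm_eq_abs, abs_of_nonneg (by linarith), mul_comm]
      exact mul_le_mul hηK (by linarith) (by linarith) hK
  have hmem0 : (x0, t0) ∈ Ks := by
    refine ⟨hx0, by simp only; linarith, le_refl _, ?_⟩
    simp [hzt0, hρ.le]
  have hcont : ContinuousOn (fun p : EN N × ℝ => v p.1 p.2 + φ p.1 p.2) Ks := by
    refine ContinuousOn.add (hz.cont.mono ?_) hφc.continuousOn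
    rintro ⟨x, t⟩ h; exact ⟨h.1, trivial⟩
  obtain ⟨⟨x1, t1⟩, hm1, hmax⟩ := hKsc.exists_isMaxOn ⟨_, hmem0⟩ hcont
  have hmax' : ∀ x t, (x, t) ∈ Ks → v x t + φ x t ≤ v x1 t1 + φ x1 t1 := fun x t h => hmax h
  by_cases hle : v x1 t1 + φ x1 t1 ≤ S
  · have h1 := (hmax' x0 t0 hmem0).trans hle
    have h2 : δ * Real.exp (-(L * D)) ≤ φ x0 t0 := by
      have : φ x0 t0 = δ * Real.exp (-(L * (t0 - s))) := by
        simp only [hφ, hzt0]; simp; field_simp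
      rw [this]
      have : t0 - s ≤ D := by linarith
      gcongr
    linarith
  exfalso
  push Not at hle
  obtain ⟨hcl, hs1, ht1, hρ1⟩ := hm1
  simp only at hcl hs1 ht1 hρ1
  have hvS := hS x1 hcl t1
  have hlt : ‖x1 - z t1‖ < ρ := by
    refine lt_of_le_of_ne hρ1 fun h => ?_
    have : φ x1 t1 = 0 := by simp [hφ, h]
    linarith
  have hφδ := hφle x1 t1 hs1 hρ1
  have hxΩ : x1 ∈ Ω := by
    by_contra h
    have : x1 ∈ frontier Ω := by rw [hz.op.frontier_eq]; exact ⟨hcl, h⟩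
    have := hz.bd x1 this t1
    linarith
  have hst1 : s < t1 := by
    refine lt_of_le_of_ne hs1 fun h => ?_
    rw [← h, hzs] at hlt
    have := hini x1 hxΩ hlt
    rw [← h] at hle hφδ
    linarith
  set g : EN N := x1 - z t1 with hg
  set q : ℝ := ρ ^ 2 - ‖g‖ ^ 2 with hq
  have hqp : 0 < q := by
    have := pow_lt_pow_left₀ hlt (norm_nonneg _) (n := 2) (by norm_num)
    rw [hq]; linarith
  set c0 : ℝ := δ / ρ ^ 4 * Real.exp (-(L * (t1 - s))) with hc0
  have hc0p : 0 < c0 := by rw [hc0]; positivity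
  -- spatial
  have hsp : ∀ ξ : EN N, (∑ i, pdE i (fun y => v y t1) x1 * ξ i - c0 * 4 * q * ∑ i, g i * ξ i = 0) ∧
      (∑ i, ∑ j, pdE2 i j (fun y => v y t1) x1 * ξ i * ξ j +
        c0 * (8 * (∑ i, g i * ξ i) ^ 2 - 4 * q * ∑ i, ξ i ^ 2) ≤ 0) := by
    intro ξ
    obtain ⟨G', hG1, hG2, hG3⟩ := aux_line (fun y => v y t1) x1 ξ (hz.c2 t1 x1 hxΩ)
    have hp : ∀ σ : ℝ, HasDerivAt (fun σ : ℝ => c0 * (ρ ^ 2 -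
        (‖g‖ ^ 2 + 2 * σ * inner ℝ g ξ + σ ^ 2 * ‖ξ‖ ^ 2)) ^ 2)
        (c0 * (2 * (ρ ^ 2 - (‖g‖ ^ 2 + 2 * σ * inner ℝ g ξ + σ ^ 2 * ‖ξ‖ ^ 2)) *
          (-(2 * inner ℝ g ξ + 2 * σ * ‖ξ‖ ^ 2)))) σ := by
      intro σ
      have := (((aux_quadpoly (‖g‖ ^ 2) (inner ℝ g ξ) (‖ξ‖ ^ 2) σ).const_sub (ρ ^ 2)).pow 2).const_mul c0
      refine this.congr_deriv ?_
      simp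
    have hp2 : HasDerivAt (fun σ : ℝ => c0 * (2 * (ρ ^ 2 - (‖g‖ ^ 2 + 2 * σ * inner ℝ g ξ + σ ^ 2 * ‖ξ‖ ^ 2)) *
          (-(2 * inner ℝ g ξ + 2 * σ * ‖ξ‖ ^ 2)))) (c0 * (8 * (inner ℝ g ξ) ^ 2 - 4 * q * ‖ξ‖ ^ 2)) 0 := by
      have h1 := ((aux_quadpoly (‖g‖ ^ 2) (inner ℝ g ξ) (‖ξ‖ ^ 2) 0).const_sub (ρ ^ 2)).const_mul 2
      have h2 := ((((hasDerivAt_id (0:ℝ)).const_mul 2).mul_const (‖ξ‖ ^ 2)).const_add (2 * inner ℝ g ξ)).neg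
      refine ((h1.mul h2).const_mul c0).congr_deriv ?_
      simp only [hq, id, Pi.neg_apply]; ring
    have key := aux_second (G := fun σ : ℝ => v (x1 + σ • ξ) t1 + c0 * (ρ ^ 2 -
        (‖g‖ ^ 2 + 2 * σ * inner ℝ g ξ + σ ^ 2 * ‖ξ‖ ^ 2)) ^ 2)
        (hG1.mono fun σ hσ => hσ.add (hp σ)) (hG2.add hp2) (by
          have hcl1 : Continuous fun σ : ℝ => x1 + σ • ξ := by fun_prop
          have e1 : ∀ᶠ σ in 𝓝 (0:ℝ), x1 + σ • ξ ∈ Ω :=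
            hcl1.continuousAt.eventually_mem (hz.op.mem_nhds (by simpa using hxΩ))
          have e2 : ∀ᶠ σ in 𝓝 (0:ℝ), ‖x1 + σ • ξ - z t1‖ < ρ := by
            have : Continuous fun σ : ℝ => ‖x1 + σ • ξ - z t1‖ := by fun_prop
            exact this.continuousAt.eventually_lt continuousAt_const (by simpa using hlt)
          filter_upwards [e1, e2] with σ h1 h2
          have h3 := hmax' (x1 + σ • ξ) t1 ⟨subset_closure h1, hs1, ht1, h2.le⟩
          have h4 : x1 + σ • ξ - z t1 = g + σ • ξ := by rw [hg]; abel
          simp only [hφ] at h3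
          rw [h4, aux_exp, ← hg] at h3
          simp only [zero_smul, add_zero, mul_zero, zero_mul, hc0]
          simp only [ne_eq, OfNat.ofNat_ne_zero, not_false_eq_true, zero_pow, zero_mul, add_zero]
          linarith)
    rw [aux_inner, aux_nsq ξ] at key
    refine ⟨?_, key.2⟩
    have := key.1
    simp only [Pi.add_apply, hG3] at this
    rw [← this, hq]; ring
  -- time
  have htime : 0 ≤ deriv (fun t => v x1 t) t1 + c0 * (4 * q * (∑ i, g i * η i) - L * q ^ 2) := by
    have h1 : HasDerivAt (fun t => v x1 t) (deriv (fun t => v x1 t) t1) t1 :=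
      (hz.dt x1 hxΩ t1).hasDerivAt
    have hsq : ∀ t, ‖x1 - z t‖ ^ 2 = ‖g‖ ^ 2 + 2 * (t - t1) * inner ℝ g (-η) + (t - t1) ^ 2 * ‖-η‖ ^ 2 := by
      intro t
      rw [← aux_exp]; congr 2; rw [hg]; simp only [hzdef]; module
    have h2 : HasDerivAt (fun t => ‖x1 - z t‖ ^ 2) (2 * inner ℝ g (-η)) t1 := by
      have := (aux_quadpoly (‖g‖ ^ 2) (inner ℝ g (-η)) (‖-η‖ ^ 2) (t1 - t1)).comp_sub_const t1 t1
      rw [funext hsq]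
      refine this.congr_deriv ?_
      simp
    have h3 : HasDerivAt (fun t => Real.exp (-(L * (t - s)))) (Real.exp (-(L * (t1 - s))) * (-(L * 1))) t1 :=
      ((((hasDerivAt_id t1).sub_const s).const_mul L).neg).exp
    have h4 := (((h2.const_sub (ρ ^ 2)).pow 2).const_mul (δ / ρ ^ 4)).mul h3
    have h5 := aux_left (G := fun t => v x1 t + φ x1 t) (h1.add h4) (by
      have e2 : ∀ᶠ r in 𝓝 t1, ‖x1 - z r‖ < ρ := by
        have : Continuous fun r : ℝ => ‖x1 - z r‖ := by fun_prop
        exact this.continuousAt.eventually_lt continuousAt_const hlt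
      filter_upwards [nhdsWithin_le_nhds e2, Ioo_mem_nhdsLT hst1] with r hr hr2
      exact hmax' x1 r ⟨hcl, hr2.1.le, hr2.2.le.trans ht1, hr.le⟩)
    refine h5.trans_eq ?_
    rw [← aux_inner, hc0, hq]
    simp only [inner_neg_right, Pi.pow_apply]
    rw [← hg]; push_cast; ring
  have hgrad : ∀ i, pdE i (fun y => v y t1) x1 = c0 * 4 * q * g i := by
    intro i
    have := (hsp (EuclideanSpace.single i 1)).1
    simp at this
    linarith
  have hT := aux_trace (fun i j => a i j x1 t1) (fun i j => pdE2 i j (fun y => v y t1) x1 +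
      c0 * (8 * (g i * g j) - 4 * q * (if i = j then 1 else 0)))
    (fun i j => hsym i j x1 hxΩ t1)
    (fun ξ => by
      have h1 := hell x1 hxΩ t1 (WithLp.toLp 2 ξ)
      refine le_trans ?_ h1
      exact mul_nonneg ha0.le (Finset.sum_nonneg fun i _ => sq_nonneg _))
    (fun ξ => by
      refine le_of_eq_of_le ?_ (hsp (WithLp.toLp 2 ξ)).2
      have e1 : (∑ i, g i * ξ i) ^ 2 = ∑ i, ∑ j, (g i * g j) * ξ i * ξ j := by
        rw [sq, Finset.sum_mul_sum]
        refine Finset.sum_congr rfl fun i _ => Finset.sum_congr rfl fun j _ => by ring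
      have e2 : ∑ i, ξ i ^ 2 = ∑ i, ∑ j, (if i = j then (1:ℝ) else 0) * ξ i * ξ j := by
        simp [sq]
      simp only
      rw [e1, e2]
      simp only [Finset.mul_sum, ← Finset.sum_sub_distrib, ← Finset.sum_add_distrib]
      refine Finset.sum_congr rfl fun i _ => Finset.sum_congr rfl fun j _ => by ring)
  have eT : ∑ i, ∑ j, a i j x1 t1 * (pdE2 i j (fun y => v y t1) x1 +
      c0 * (8 * (g i * g j) - 4 * q * (if i = j then 1 else 0))) =
      ∑ i, ∑ j, a i j x1 t1 * pdE2 i j (fun y => v y t1) x1 +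
      c0 * (8 * ∑ i, ∑ j, a i j x1 t1 * g i * g j - 4 * q * ∑ i, a i i x1 t1) := by
    have e2 : ∑ i, a i i x1 t1 = ∑ i, ∑ j, (if i = j then (1:ℝ) else 0) * a i j x1 t1 := by
      simp
    rw [e2]
    simp only [Finset.mul_sum, ← Finset.sum_sub_distrib, ← Finset.sum_add_distrib]
    refine Finset.sum_congr rfl fun i _ => Finset.sum_congr rfl fun j _ => by ring
  rw [eT] at hT
  have heq := hz.eqn x1 hxΩ t1
  unfold parOpE at heq
  have hbsum : ∑ i, b i x1 t1 * pdE i (fun y => v y t1) x1 = c0 * 4 * q * ∑ i, b i x1 t1 * g i := by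
    rw [Finset.mul_sum]
    refine Finset.sum_congr rfl fun i _ => by rw [hgrad]; ring
  rw [hbsum] at heq
  have hcv : c x1 t1 * v x1 t1 ≤ 0 :=
    mul_nonpos_of_nonpos_of_nonneg (hc x1 hxΩ t1) (by linarith)
  have b1 : |∑ i, b i x1 t1 * g i| ≤ N * (Bb * ρ) :=
    aux_sum_abs _ g Bb ρ (fun i => hBb i x1 hxΩ t1) hρ1
  have b2 : ∑ i, g i * η i ≤ ρ * K := by
    rw [← aux_inner]
    exact (real_inner_le_norm _ _).trans (mul_le_mul hρ1 hηK (norm_nonneg _) hρ.le)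
  have b3 : ∑ i, a i i x1 t1 ≤ N * Ab := by
    have : ∀ i ∈ (Finset.univ : Finset (Fin N)), a i i x1 t1 ≤ Ab := fun i _ =>
      (le_abs_self _).trans (hAb i i x1 hxΩ t1)
    simpa using Finset.sum_le_sum this
  have b4 := hell x1 hxΩ t1 g
  rw [← aux_nsq] at b4
  have hng : ‖g‖ ^ 2 = ρ ^ 2 - q := by rw [hq]; ring
  rw [hng] at b4
  have b1' := (abs_le.1 b1).2
  have hfin : 0 < L * q ^ 2 - (C2 + 8 * a0) * q + 8 * a0 * ρ ^ 2 := by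
    have hP : 0 < 8 * a0 * ρ ^ 2 := by positivity
    have hPL : 8 * a0 * ρ ^ 2 * L = (C2 + 8 * a0) ^ 2 := by rw [hL]; field_simp
    exact aux_quad_pos L q _ _ hP hPL
  have hbr : 0 < - (4 * q * (∑ i, g i * η i) - L * q ^ 2) +
      (8 * ∑ i, ∑ j, a i j x1 t1 * g i * g j - 4 * q * ∑ i, a i i x1 t1) -
      4 * q * ∑ i, b i x1 t1 * g i := by
    have := mul_le_mul_of_nonneg_left (add_le_add (add_le_add b2 b3) b1') hqp.le
    rw [hC2] at hfin
    linarith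
  have := mul_pos hc0p hbr
  linarith

lemma aux_rpow (m B C : ℝ) (hm : 0 < m) :
    ∃ G' : ℝ → ℝ, (∀ᶠ s in 𝓝 (0:ℝ), HasDerivAt
      (fun s : ℝ => (m + 2 * s * B + s ^ 2 * C) ^ (1/4 : ℝ)) (G' s) s) ∧
      HasDerivAt G' (1/2 * m ^ (1/4 - 1 : ℝ) * C - 3/4 * (m ^ (1/4 - 1 : ℝ) / m) * B ^ 2) 0 ∧
      G' 0 = 1/2 * m ^ (1/4 - 1 : ℝ) * B := by
  refine ⟨fun s => (2 * B + 2 * s * C) * (1/4) * (m + 2 * s * B + s ^ 2 * C) ^ (1/4 - 1 : ℝ), ?_, ?_, ?_⟩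
  · have hc : ContinuousAt (fun s : ℝ => m + 2 * s * B + s ^ 2 * C) 0 := by fun_prop
    have : ∀ᶠ s in 𝓝 (0:ℝ), m + 2 * s * B + s ^ 2 * C ≠ 0 :=
      hc.eventually_ne (by simpa using hm.ne')
    filter_upwards [this] with s hs
    exact (aux_quadpoly m B C s).rpow_const (Or.inl hs)
  · have h1 := (((((hasDerivAt_id (0:ℝ)).const_mul 2).mul_const C).const_add (2 * B)).mul_const (1/4))
    have h2 := (aux_quadpoly m B C 0).rpow_const (p := (1/4 - 1 : ℝ)) (Or.inl (by simpa using hm.ne'))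
    refine (h1.mul h2).congr_deriv ?_
    have e : m + 2 * 0 * B + 0 ^ 2 * C = m := by ring
    simp only [e, id]
    rw [Real.rpow_sub_one hm.ne' (1/4 - 1)]
    ring
  · have e : m + 2 * 0 * B + 0 ^ 2 * C = m := by ring
    simp only [e]
    ring

set_option maxHeartbeats 1000000 in
lemma aux_mod {N : ℕ} {Ω : Set (EN N)} {a : Fin N → Fin N → EN N → ℝ → ℝ}
    {b : Fin N → EN N → ℝ → ℝ} {c : EN N → ℝ → ℝ} {v : EN N → ℝ → ℝ}
    (hz : ZSol Ω a b c v)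
    (hsym : ∀ i j, ∀ x ∈ Ω, ∀ t : ℝ, a i j x t = a j i x t)
    (a0 Ab Bb Cb V : ℝ) (ha0 : 0 < a0)
    (hell : ∀ x ∈ Ω, ∀ (t : ℝ) (ξ : EN N), a0 * ∑ i, ξ i ^ 2 ≤ ∑ i, ∑ j, a i j x t * ξ i * ξ j)
    (hAb0 : 0 ≤ Ab) (hBb0 : 0 ≤ Bb) (hCb0 : 0 ≤ Cb) (hV0 : 0 ≤ V)
    (hAb : ∀ i j, ∀ x ∈ Ω, ∀ t : ℝ, |a i j x t| ≤ Ab)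
    (hBb : ∀ i, ∀ x ∈ Ω, ∀ t : ℝ, |b i x t| ≤ Bb)
    (hCb : ∀ x ∈ Ω, ∀ t : ℝ, |c x t| ≤ Cb)
    (hV : ∀ x ∈ Ω, ∀ t : ℝ, |v x t| ≤ V)
    (huc : ∀ e : ℝ, 0 < e → ∃ r : ℝ, 0 < r ∧ ∀ x ∈ Ω, ∀ y ∈ Ω, ‖x - y‖ ≤ r →
      ∀ t i j, |a i j x t - a i j y t| ≤ e) :
    ∃ A r1 : ℝ, 0 < A ∧ 0 < r1 ∧ ∀ (z : EN N) (s0 : ℝ), (∀ x, ‖x - z‖ ≤ 2 → x ∈ Ω) →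
      ∀ y, ‖z - y‖ ≤ r1 → v z s0 - v y s0 ≤ A * (‖z - y‖ ^ 2) ^ (1/4 : ℝ) := by
  set ε : ℝ := a0 / (12 * (N + 1)) with hε
  have hεp : 0 < ε := by rw [hε]; positivity
  obtain ⟨ra, hra, huca⟩ := huc (ε / (N + 1)) (by positivity)
  set r1 : ℝ := min (min 1 ra) (a0 / (8 * (N * Bb + 1))) with hr1
  have hr1p : 0 < r1 := by rw [hr1]; positivity
  have hr11 : r1 ≤ 1 := (min_le_left _ _).trans (min_le_left _ _)
  have hr1a : r1 ≤ ra := (min_le_left _ _).trans (min_le_right _ _)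
  have hr1b : N * Bb * r1 ≤ a0 / 8 := by
    have h1 : r1 ≤ a0 / (8 * (N * Bb + 1)) := min_le_right _ _
    have h2 : 0 ≤ N * Bb := by positivity
    calc N * Bb * r1 ≤ (N * Bb + 1) * (a0 / (8 * (N * Bb + 1))) :=
          mul_le_mul (by linarith) h1 hr1p.le (by linarith)
      _ = a0 / 8 := by field_simp
  set B : ℝ := 2 * V + 1 with hB
  have hBp : 0 < B := by rw [hB]; positivity
  set C' : ℝ := 2 * B * (a0 / 2 + N * Ab + N * ε) + 2 * B * (N * Bb) + 2 * (Cb * V) with hC'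
  have hC'0 : 0 ≤ C' := by rw [hC']; positivity
  set A : ℝ := 4 * (C' + 2 * B + 1) / a0 + 2 * V / (r1 ^ 2) ^ (1/4 : ℝ) with hA
  have hr1q : 0 < (r1 ^ 2) ^ (1/4 : ℝ) := by positivity
  have hA1 : 4 * (C' + 2 * B + 1) / a0 ≤ A := by
    rw [hA]; have : 0 ≤ 2 * V / (r1 ^ 2) ^ (1/4 : ℝ) := by positivity
    linarith
  have hA1' : C' + 2 * B + 1 ≤ a0 * A / 4 := by
    rw [div_le_iff₀ ha0] at hA1; linarith
  have hA2 : 2 * V ≤ A * (r1 ^ 2) ^ (1/4 : ℝ) := by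
    rw [← div_le_iff₀ hr1q, hA]
    have : 0 ≤ 4 * (C' + 2 * B + 1) / a0 := by positivity
    linarith
  have hAp : 0 < A := lt_of_lt_of_le (by positivity) hA1
  clear_value A
  refine ⟨A, r1, hAp, hr1p, ?_⟩
  intro z s0 hball y hy
  set Φ : EN N → EN N → ℝ → ℝ := fun x y t => v x t - v y t - A * (‖x - y‖ ^ 2) ^ (1/4 : ℝ) -
    B * ‖x - z‖ ^ 2 - B * (t - s0) ^ 2 with hΦ
  set Ks : Set (EN N × EN N × ℝ) :=
    {p | ‖p.1 - z‖ ≤ 1 ∧ ‖p.1 - p.2.1‖ ≤ r1 ∧ s0 - 1 ≤ p.2.2 ∧ p.2.2 ≤ s0} with hKs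
  have hin : ∀ x y t, (x, y, t) ∈ Ks → x ∈ Ω ∧ y ∈ Ω := by
    rintro x y t ⟨h1, h2, -, -⟩
    simp only at h1 h2
    refine ⟨hball x (by linarith), hball y ?_⟩
    have : y - z = (x - z) - (x - y) := by abel
    rw [this]
    exact (norm_sub_le _ _).trans (by linarith)
  have hKsc : IsCompact Ks := by
    refine IsCompact.of_isClosed_subset
      ((isCompact_closedBall z 2).prod
        ((isCompact_closedBall z 2).prod (isCompact_Icc (a := s0 - 1) (b := s0)))) ?_ ?_
    · have e : Ks = {p | ‖p.1 - z‖ ≤ 1} ∩ {p | ‖p.1 - p.2.1‖ ≤ r1} ∩ {p | s0 - 1 ≤ p.2.2} ∩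
        {p | p.2.2 ≤ s0} := by
        ext p; simp [hKs, and_assoc]
      rw [e]
      refine ((IsClosed.inter ?_ ?_).inter ?_).inter ?_
      · exact isClosed_le (by fun_prop) continuous_const
      · exact isClosed_le (by fun_prop) continuous_const
      · exact isClosed_le continuous_const (by fun_prop)
      · exact isClosed_le (by fun_prop) continuous_const
    · rintro ⟨x, y, t⟩ ⟨h1, h2, h3, h4⟩
      simp only at h1 h2 h3 h4
      refine ⟨?_, ?_, h3, h4⟩
      · simp only [Metric.mem_closedBall, dist_eq_norm]; linarith
      · simp only [Metric.mem_closedBall, dist_eq_norm]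
        have : y - z = (x - z) - (x - y) := by abel
        rw [this]
        exact (norm_sub_le _ _).trans (by linarith)
  have hmem0 : (z, y, s0) ∈ Ks := ⟨by simp, hy, by simp, le_refl _⟩
  have hcont : ContinuousOn (fun p : EN N × EN N × ℝ => Φ p.1 p.2.1 p.2.2) Ks := by
    have c1 : ContinuousOn (fun p : EN N × EN N × ℝ => v p.1 p.2.2) Ks :=
      hz.cont.comp (f := fun p : EN N × EN N × ℝ => (p.1, p.2.2)) (by fun_prop)
        (fun p hp => ⟨subset_closure (hin _ _ _ hp).1, trivial⟩)
    have c2 : ContinuousOn (fun p : EN N × EN N × ℝ => v p.2.1 p.2.2) Ks :=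
      hz.cont.comp (f := fun p : EN N × EN N × ℝ => (p.2.1, p.2.2)) (by fun_prop)
        (fun p hp => ⟨subset_closure (hin _ _ _ hp).2, trivial⟩)
    have c3 : Continuous (fun p : EN N × EN N × ℝ => (‖p.1 - p.2.1‖ ^ 2) ^ (1/4 : ℝ)) :=
      Continuous.rpow_const (by fun_prop) (fun _ => Or.inr (by norm_num))
    have c4 : Continuous (fun p : EN N × EN N × ℝ => B * ‖p.1 - z‖ ^ 2) := by fun_prop
    have c5 : Continuous (fun p : EN N × EN N × ℝ => B * (p.2.2 - s0) ^ 2) := by fun_prop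
    exact (((c1.sub c2).sub (c3.const_mul A).continuousOn).sub c4.continuousOn).sub c5.continuousOn
  obtain ⟨⟨x1, y1, t1⟩, hm1, hmax⟩ := hKsc.exists_isMaxOn ⟨_, hmem0⟩ hcont
  have hmax' : ∀ x y t, (x, y, t) ∈ Ks → Φ x y t ≤ Φ x1 y1 t1 := fun x y t h => hmax h
  by_cases hle : Φ x1 y1 t1 ≤ 0
  · have h1 := (hmax' z y s0 hmem0).trans hle
    simp only [hΦ] at h1
    simp at h1
    simp only [one_div]
    linarith
  exfalso
  push Not at hle
  obtain ⟨hx1, hy1⟩ := hin _ _ _ hm1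
  obtain ⟨k1, k2, k3, k4⟩ := hm1
  simp only at k1 k2 k3 k4
  have vx := abs_le.1 (hV x1 hx1 t1)
  have vy := abs_le.1 (hV y1 hy1 t1)
  have hle' := hle
  simp only [hΦ] at hle'
  have n1 : 0 ≤ A * (‖x1 - y1‖ ^ 2) ^ (1/4 : ℝ) := by positivity
  have n2 : 0 ≤ B * ‖x1 - z‖ ^ 2 := by positivity
  have n3 : 0 ≤ B * (t1 - s0) ^ 2 := by positivity
  have k1' : ‖x1 - z‖ < 1 := by
    refine lt_of_le_of_ne k1 fun h => ?_
    rw [h] at hle'; linarith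
  have k3' : s0 - 1 < t1 := by
    refine lt_of_le_of_ne k3 fun h => ?_
    have : (t1 - s0) ^ 2 = 1 := by rw [← h]; ring
    rw [this] at hle'; linarith
  have k2' : ‖x1 - y1‖ < r1 := by
    refine lt_of_le_of_ne k2 fun h => ?_
    rw [h] at hle'; linarith
  have hne : x1 ≠ y1 := by
    intro h
    rw [h] at hle' n1 n2; linarith
  set h : EN N := x1 - y1 with hh
  set m : ℝ := ‖h‖ ^ 2 with hm
  have hhp : 0 < ‖h‖ := norm_pos_iff.2 (sub_ne_zero.2 hne)
  have hmp : 0 < m := by positivity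
  set P : ℝ := m ^ (1/4 - 1 : ℝ) with hP
  have hPp : 0 < P := by positivity
  have hP1 : 1 ≤ P := by
    apply Real.one_le_rpow_of_pos_of_le_one_of_nonpos hmp
    · rw [hm]; exact pow_le_one₀ (norm_nonneg _) (by linarith)
    · norm_num
  -- spatial
  have hsp : ∀ ξ η : EN N,
      (∑ i, pdE i (fun y => v y t1) x1 * ξ i - ∑ i, pdE i (fun y => v y t1) y1 * η i
        - A * (1/2 * P * inner ℝ h (ξ - η)) - B * (2 * inner ℝ (x1 - z) ξ) = 0) ∧
      (∑ i, ∑ j, pdE2 i j (fun y => v y t1) x1 * ξ i * ξ j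
        - ∑ i, ∑ j, pdE2 i j (fun y => v y t1) y1 * η i * η j
        - A * (1/2 * P * ‖ξ - η‖ ^ 2 - 3/4 * (P / m) * (inner ℝ h (ξ - η)) ^ 2)
        - B * (2 * ‖ξ‖ ^ 2) ≤ 0) := by
    intro ξ η
    obtain ⟨G, hG1, hG2, hG3⟩ := aux_line (fun y => v y t1) x1 ξ (hz.c2 t1 x1 hx1)
    obtain ⟨H, hH1, hH2, hH3⟩ := aux_line (fun y => v y t1) y1 η (hz.c2 t1 y1 hy1)
    obtain ⟨R, hR1, hR2, hR3⟩ := aux_rpow m (inner ℝ h (ξ - η)) (‖ξ - η‖ ^ 2) hmp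
    have hq1 : ∀ σ : ℝ, HasDerivAt (fun σ : ℝ => B * (‖x1 - z‖ ^ 2 + 2 * σ * inner ℝ (x1 - z) ξ + σ ^ 2 * ‖ξ‖ ^ 2))
      (B * (2 * inner ℝ (x1 - z) ξ + 2 * σ * ‖ξ‖ ^ 2)) σ := fun σ => (aux_quadpoly _ _ _ σ).const_mul B
    have hq2 : HasDerivAt (fun σ : ℝ => B * (2 * inner ℝ (x1 - z) ξ + 2 * σ * ‖ξ‖ ^ 2))
      (B * (2 * ‖ξ‖ ^ 2)) 0 := by
      refine (((((hasDerivAt_id (0:ℝ)).const_mul 2).mul_const (‖ξ‖ ^ 2)).const_add _).const_mul B).congr_deriv ?_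
      ring
    have key := aux_second (G := fun σ : ℝ => v (x1 + σ • ξ) t1 - v (y1 + σ • η) t1
        - A * (m + 2 * σ * inner ℝ h (ξ - η) + σ ^ 2 * ‖ξ - η‖ ^ 2) ^ (1/4 : ℝ)
        - B * (‖x1 - z‖ ^ 2 + 2 * σ * inner ℝ (x1 - z) ξ + σ ^ 2 * ‖ξ‖ ^ 2))
        (by
          filter_upwards [hG1, hH1, hR1] with σ g1 g2 g3
          exact ((g1.sub g2).sub (g3.const_mul A)).sub (hq1 σ))
        (((hG2.sub hH2).sub (hR2.const_mul A)).sub hq2) (by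
          have e1 : ∀ᶠ σ in 𝓝 (0:ℝ), ‖x1 + σ • ξ - z‖ < 1 := by
            have : Continuous fun σ : ℝ => ‖x1 + σ • ξ - z‖ := by fun_prop
            exact this.continuousAt.eventually_lt continuousAt_const (by simpa using k1')
          have e2 : ∀ᶠ σ in 𝓝 (0:ℝ), ‖x1 + σ • ξ - (y1 + σ • η)‖ < r1 := by
            have : Continuous fun σ : ℝ => ‖x1 + σ • ξ - (y1 + σ • η)‖ := by fun_prop
            exact this.continuousAt.eventually_lt continuousAt_const (by simpa using k2')
          filter_upwards [e1, e2] with σ h1 h2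
          have h3 := hmax' (x1 + σ • ξ) (y1 + σ • η) t1 ⟨h1.le, h2.le, k3, k4⟩
          have h4 : x1 + σ • ξ - (y1 + σ • η) = h + σ • (ξ - η) := by rw [hh]; module
          have h5 : x1 + σ • ξ - z = (x1 - z) + σ • ξ := by abel
          simp only [hΦ] at h3
          rw [h4, h5, aux_exp, aux_exp, ← hh, ← hm] at h3
          simp only [zero_smul, add_zero, mul_zero, zero_mul]
          simp only [ne_eq, OfNat.ofNat_ne_zero, not_false_eq_true, zero_pow, zero_mul, add_zero]
          linarith)
    refine ⟨?_, key.2⟩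
    have k := key.1
    simp only [Pi.sub_apply, hG3, hH3, hR3] at k
    rw [← k]; ring
  -- time
  have htime : 0 ≤ deriv (fun t => v x1 t) t1 - deriv (fun t => v y1 t) t1 - B * (2 * (t1 - s0)) := by
    have h1 : HasDerivAt (fun t => v x1 t) (deriv (fun t => v x1 t) t1) t1 :=
      (hz.dt x1 hx1 t1).hasDerivAt
    have h2 : HasDerivAt (fun t => v y1 t) (deriv (fun t => v y1 t) t1) t1 :=
      (hz.dt y1 hy1 t1).hasDerivAt
    have h3 : HasDerivAt (fun t => B * (t - s0) ^ 2) (B * (2 * (t1 - s0))) t1 := by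
      refine ((((hasDerivAt_id t1).sub_const s0).pow 2).const_mul B).congr_deriv ?_
      simp
    refine aux_left (G := fun t => v x1 t - v y1 t - B * (t - s0) ^ 2) ((h1.sub h2).sub h3) ?_
    filter_upwards [Ioo_mem_nhdsLT k3'] with r hr
    have h4 := hmax' x1 y1 r ⟨k1, k2, hr.1.le, hr.2.le.trans k4⟩
    simp only [hΦ] at h4
    linarith
  have hgx : ∀ i, pdE i (fun y => v y t1) x1 = A * (1/2 * P) * h i + B * 2 * (x1 - z) i := by
    intro i
    have := (hsp (EuclideanSpace.single i 1) 0).1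
    rw [aux_inner, aux_inner] at this
    simp at this
    simp
    linarith
  have hgy : ∀ i, pdE i (fun y => v y t1) y1 = A * (1/2 * P) * h i := by
    intro i
    have := (hsp 0 (EuclideanSpace.single i 1)).1
    rw [aux_inner, aux_inner] at this
    simp at this
    linarith
  have halg := aux_algebra (fun i j => a i j x1 t1) (fun i j => a i j y1 t1)
    (fun i j => pdE2 i j (fun y => v y t1) x1) (fun i j => pdE2 i j (fun y => v y t1) y1)
    (fun i => h i) a0 Ab ε m (2 * B) (A * (1/2 * P)) (-(A * (3/4 * (P / m))))
    (aux_nsq h).symm hmp (by positivity) (by positivity)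
    (by have : 0 ≤ A * (3/4 * (P / m)) := by positivity
        linarith) ha0 hε (fun i j => hsym i j x1 hx1 t1) (fun i j => hsym i j y1 hy1 t1)
    (fun ξ => hell x1 hx1 t1 (WithLp.toLp 2 ξ)) (fun i j => hAb i j x1 hx1 t1)
    (fun i j => huca x1 hx1 y1 hy1 (k2.trans hr1a) t1 i j)
    (fun ξ η => by
      have := (hsp (WithLp.toLp 2 ξ) (WithLp.toLp 2 η)).2
      rw [aux_inner, aux_nsq, aux_nsq] at this
      simp only [PiLp.sub_apply] at this
      linarith)
  have hPm : -(A * (3/4 * (P / m))) * m = - (3/4 * (A * P)) := by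
    field_simp
  have hNε : 3 * N * ε ≤ a0 / 4 := by
    rw [hε]
    have : (0:ℝ) ≤ N := by positivity
    rw [← mul_div_assoc, div_le_div_iff₀ (by positivity) (by positivity)]
    nlinarith
  have heqx := hz.eqn x1 hx1 t1
  have heqy := hz.eqn y1 hy1 t1
  unfold parOpE at heqx heqy
  have hbx : ∑ i, b i x1 t1 * pdE i (fun y => v y t1) x1 =
      A * (1/2 * P) * ∑ i, b i x1 t1 * h i + B * 2 * ∑ i, b i x1 t1 * (x1 - z) i := by
    rw [Finset.mul_sum, Finset.mul_sum, ← Finset.sum_add_distrib]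
    refine Finset.sum_congr rfl fun i _ => by rw [hgx]; ring
  have hby : ∑ i, b i y1 t1 * pdE i (fun y => v y t1) y1 =
      A * (1/2 * P) * ∑ i, b i y1 t1 * h i := by
    rw [Finset.mul_sum]
    refine Finset.sum_congr rfl fun i _ => by rw [hgy]; ring
  rw [hbx] at heqx
  rw [hby] at heqy
  have b1 := (abs_le.1 (aux_sum_abs _ h Bb r1 (fun i => hBb i x1 hx1 t1) k2)).2
  have b2 := (abs_le.1 (aux_sum_abs _ h Bb r1 (fun i => hBb i y1 hy1 t1) k2)).1
  have b3 := (abs_le.1 (aux_sum_abs _ (x1 - z) Bb 1 (fun i => hBb i x1 hx1 t1) k1)).2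
  have hcx : c x1 t1 * v x1 t1 ≤ Cb * V := by
    refine (le_abs_self _).trans ?_
    rw [abs_mul]
    exact mul_le_mul (hCb x1 hx1 t1) (hV x1 hx1 t1) (abs_nonneg _) hCb0
  have hcy : -(c y1 t1 * v y1 t1) ≤ Cb * V := by
    refine (neg_le_abs _).trans ?_
    rw [abs_mul]
    exact mul_le_mul (hCb y1 hy1 t1) (hV y1 hy1 t1) (abs_nonneg _) hCb0
  set AP : ℝ := A * P with hAP
  have hAPp : 0 < AP := by positivity
  have hAPA : A ≤ AP := by rw [hAP]; exact le_mul_of_one_le_right hAp.le hP1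
  have f1 : A * (1/2 * P) * (∑ i, b i x1 t1 * h i) - A * (1/2 * P) * (∑ i, b i y1 t1 * h i)
      ≤ AP * (a0 / 8) := by
    have : A * (1/2 * P) * ((∑ i, b i x1 t1 * h i) - ∑ i, b i y1 t1 * h i) ≤
      A * (1/2 * P) * (2 * (a0 / 8)) := by
      apply mul_le_mul_of_nonneg_left _ (by positivity)
      linarith
    rw [hAP]; linarith
  have f2 : B * 2 * ∑ i, b i x1 t1 * (x1 - z) i ≤ B * 2 * (N * Bb) :=
    mul_le_mul_of_nonneg_left (by linarith) (by positivity)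
  have f3 : 3 * N * ε * (A * (1/2 * P)) ≤ a0 / 4 * (A * (1/2 * P)) :=
    mul_le_mul_of_nonneg_right hNε (by positivity)
  have f4 : B * (2 * (t1 - s0)) ≥ - (2 * B) := by nlinarith
  have f5 : a0 * A / 4 ≤ a0 * AP / 4 := by
    have := mul_le_mul_of_nonneg_left hAPA ha0.le
    linarith
  have f6 : a0 / 2 * (4 * -(A * (3/4 * (P / m))) * m + 4 * (A * (1/2 * P)) + 2 * B) =
      - (a0 * AP / 2) + a0 * B := by
    have : 4 * -(A * (3/4 * (P / m))) * m = - (3 * AP) := by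
      rw [mul_assoc, hPm, hAP]; ring
    rw [this, hAP]; ring
  have f7 : a0 / 4 * (A * (1/2 * P)) = a0 * AP / 8 := by rw [hAP]; ring
  rw [f6] at halg
  rw [hC'] at hA1'
  linarith

lemma aux_core {N : ℕ} {Ω : Set (EN N)} {a : Fin N → Fin N → EN N → ℝ → ℝ}
    {b : Fin N → EN N → ℝ → ℝ} {c : EN N → ℝ → ℝ} {v : EN N → ℝ → ℝ} (u : EN N → ℝ → ℝ)
    (hz : ZSol Ω a b c v) (hstd : StdCoeffsOn Ω a b c)
    (hc : ∀ x ∈ Ω, ∀ t : ℝ, c x t ≤ 0)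
    (r : ℝ) (hr : 0 < r)
    (hext : ∀ q ∈ frontier Ω, ∃ y : EN N, Metric.ball y r ⊆ Ωᶜ ∧ dist q y = r)
    (p : EN N) (τ : ℝ) (hτ : 0 ≤ τ) (M : ℝ)
    (hM : ∀ x ∈ closure Ω, ∀ t : ℝ, |u x t| ≤ M)
    (hpc : ∀ x ∈ closure Ω, x + p ∈ closure Ω)
    (hv : ∀ x ∈ closure Ω, ∀ t, v x t = u (x + p) (t + τ) - u x t) :
    ∀ x ∈ closure Ω, ∀ t, v x t ≤ 0 := by
  obtain ⟨hab, hauc, hbb, -, ⟨C0, hC0⟩, -, hsym, a0, a1, ha0, -, hell⟩ := hstd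
  have hell' := fun x hx t ξ => (hell x hx t ξ).1
  choose Am hAm using hab
  choose Bm hBm using hbb
  have hAb : ∀ i j, ∀ x ∈ Ω, ∀ t, |a i j x t| ≤ ∑ i, ∑ j, |Am i j| := by
    intro i j x hx t
    refine (hAm i j x hx t).trans ((le_abs_self _).trans ?_)
    have h1 : |Am i j| ≤ ∑ j, |Am i j| :=
      Finset.single_le_sum (f := fun j => |Am i j|) (fun _ _ => abs_nonneg _) (Finset.mem_univ j)
    exact h1.trans (Finset.single_le_sum (f := fun i => ∑ j, |Am i j|)
      (fun _ _ => Finset.sum_nonneg fun _ _ => abs_nonneg _) (Finset.mem_univ i))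
  have hBb : ∀ i, ∀ x ∈ Ω, ∀ t, |b i x t| ≤ ∑ i, |Bm i| := by
    intro i x hx t
    refine (hBm i x hx t).trans ((le_abs_self _).trans ?_)
    exact Finset.single_le_sum (f := fun j => |Bm j|) (fun _ _ => abs_nonneg _) (Finset.mem_univ i)
  have hAb0 : 0 ≤ ∑ i, ∑ j, |Am i j| :=
    Finset.sum_nonneg fun _ _ => Finset.sum_nonneg fun _ _ => abs_nonneg _
  have hBb0 : 0 ≤ ∑ i, |Bm i| := Finset.sum_nonneg fun _ _ => abs_nonneg _
  generalize (∑ i, ∑ j, |Am i j|) = Ab at *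
  generalize (∑ i, |Bm i|) = Bb at *
  have huc : ∀ e, 0 < e → ∃ r, 0 < r ∧ ∀ x ∈ Ω, ∀ y ∈ Ω, ‖x - y‖ ≤ r →
      ∀ t i j, |a i j x t - a i j y t| ≤ e := by
    intro e he
    have h1 : ∀ i j, ∀ᶠ r in 𝓝[>] (0 : ℝ), ∀ x ∈ Ω, ∀ y ∈ Ω, ‖x - y‖ ≤ r →
        ∀ t, |a i j x t - a i j y t| ≤ e := by
      intro i j
      obtain ⟨d, hd, h⟩ := Metric.uniformContinuousOn_iff.1 (hauc i j) e he
      filter_upwards [Ioo_mem_nhdsGT hd] with r hr x hx y hy hxy t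
      have := h (x, t) ⟨hx, trivial⟩ (y, t) ⟨hy, trivial⟩ (by
        rw [Prod.dist_eq, dist_self, dist_eq_norm]
        exact max_lt (lt_of_le_of_lt hxy hr.2) hd)
      rw [Real.dist_eq] at this
      exact this.le
    have h2 : ∀ᶠ r in 𝓝[>] (0 : ℝ), ∀ i j, ∀ x ∈ Ω, ∀ y ∈ Ω, ‖x - y‖ ≤ r →
        ∀ t, |a i j x t - a i j y t| ≤ e :=
      eventually_all.2 fun i => eventually_all.2 fun j => h1 i j
    obtain ⟨r, hr, hr0⟩ := (h2.and self_mem_nhdsWithin).exists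
    exact ⟨r, hr0, fun x hx y hy hxy t i j => hr i j x hx y hy hxy t⟩
  have hsub : Ω ⊆ closure Ω := subset_closure
  have hv2 : ∀ x ∈ closure Ω, ∀ t, |v x t| ≤ 2 * M := by
    intro x hx t
    rw [hv x hx t]
    have h1 := abs_le.1 (hM _ (hpc x hx) (t + τ))
    have h2 := abs_le.1 (hM x hx t)
    rw [abs_le]; constructor <;> linarith [h1.1, h1.2, h2.1, h2.2]
  by_contra hcon
  push Not at hcon
  obtain ⟨xx, hxx, tt, hpos⟩ := hcon
  have hM0 : 0 ≤ M := (abs_nonneg _).trans (hM xx hxx tt)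
  set T : Set ℝ := {w | ∃ x ∈ closure Ω, ∃ t, w = v x t} with hT
  have hTb : BddAbove T := ⟨2 * M, by
    rintro w ⟨x, hx, t, rfl⟩; exact (abs_le.1 (hv2 x hx t)).2⟩
  have hTn : T.Nonempty := ⟨_, xx, hxx, tt, rfl⟩
  set S := sSup T with hSdef
  have hS : ∀ x ∈ closure Ω, ∀ t, v x t ≤ S := fun x hx t => le_csSup hTb ⟨x, hx, t, rfl⟩
  have hS0 : 0 < S := hpos.trans_le (hS xx hxx tt)
  obtain ⟨k, hk⟩ := exists_nat_gt (2 * M / (S / 2))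
  rw [div_lt_iff₀ (by linarith)] at hk
  have hkp : 0 ≤ k * ‖p‖ := by positivity
  obtain ⟨κ1, hκ1, H1⟩ := aux_tube hz hc hsym a0 Ab Bb ha0 hell' hAb0 hBb0 hAb hBb S hS
    (k * ‖p‖ + 5 + r) r 1 S (by positivity) hr hS0 le_rfl
  obtain ⟨A, r1, hA, hr1, H2⟩ := aux_mod hz hsym a0 Ab Bb |C0| (2 * M) ha0 hell' hAb0 hBb0
    (abs_nonneg _) (by linarith) hAb hBb (fun x hx t => (hC0 x hx t).trans (le_abs_self _))
    (fun x hx t => hv2 x (hsub hx) t) huc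
  obtain ⟨ρ, hρ, hρ1, hρr, hρA⟩ : ∃ ρ : ℝ, 0 < ρ ∧ ρ ≤ 1 ∧ ρ ≤ r1 ∧
      A * (ρ ^ 2) ^ (1/4 : ℝ) ≤ S / 4 := by
    have h1 : Tendsto (fun ρ : ℝ => A * (ρ ^ 2) ^ (1/4 : ℝ)) (𝓝[>] 0) (𝓝 0) := by
      have : ContinuousAt (fun ρ : ℝ => A * (ρ ^ 2) ^ (1/4 : ℝ)) 0 := by
        refine continuousAt_const.mul (ContinuousAt.rpow_const (by fun_prop) (Or.inr (by norm_num)))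
      have h := this.tendsto
      simp only [ne_eq, OfNat.ofNat_ne_zero, not_false_eq_true, zero_pow] at h
      rw [Real.zero_rpow (by norm_num), mul_zero] at h
      exact h.mono_left nhdsWithin_le_nhds
    have h2 : ∀ᶠ ρ in 𝓝[>] (0:ℝ), A * (ρ ^ 2) ^ (1/4 : ℝ) < S / 4 :=
      h1.eventually (gt_mem_nhds (by linarith))
    obtain ⟨ρ, ⟨ha, hb⟩, hc⟩ := ((h2.and (Ioo_mem_nhdsGT (lt_min hr1 one_pos))).and
      self_mem_nhdsWithin).exists
    exact ⟨ρ, hc, (hb.2.trans_le (min_le_right _ _)).le, (hb.2.trans_le (min_le_left _ _)).le,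
      ha.le⟩
  obtain ⟨κ2, hκ2, H3⟩ := aux_tube hz hc hsym a0 Ab Bb ha0 hell' hAb0 hBb0 hAb hBb S hS
    (k * ‖p‖) ρ (1 + k * τ) (S / 4) hkp hρ (by linarith) (by linarith)
  obtain ⟨w, ⟨x0, hx0, t0, rfl⟩, hw⟩ := exists_lt_of_lt_csSup hTn
    (show S - min (min κ1 κ2) S < sSup T by
      have : 0 < min (min κ1 κ2) S := lt_min (lt_min hκ1 hκ2) hS0
      linarith)
  have hw1 : S - κ1 < v x0 t0 := by
    linarith [(min_le_left (min κ1 κ2) S).trans (min_le_left κ1 κ2)]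
  have hw2 : S - κ2 < v x0 t0 := by
    linarith [(min_le_left (min κ1 κ2) S).trans (min_le_right κ1 κ2)]
  have hw3 : 0 < v x0 t0 := by linarith [min_le_right (min κ1 κ2) S]
  have hx0Ω : x0 ∈ Ω := by
    by_contra hn
    have : x0 ∈ frontier Ω := by
      rw [hz.op.frontier_eq]; exact ⟨hx0, hn⟩
    rw [hz.bd x0 this] at hw3
    exact lt_irrefl _ hw3
  have hnf : ∀ q ∈ frontier Ω, ¬ ‖x0 - q‖ ≤ k * ‖p‖ + 5 := by
    intro q hq hle
    obtain ⟨y, hy, hqy⟩ := hext q hq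
    have := H1 y (t0 - 1) x0 t0 hx0 (by linarith) (by linarith)
      (by
        rw [dist_eq_norm] at hqy
        have : x0 - y = (x0 - q) + (q - y) := by abel
        rw [this]
        exact (norm_add_le _ _).trans (by linarith))
      (fun x hx hxy => absurd hx (hy (by rw [Metric.mem_ball, dist_eq_norm]; exact hxy)))
    linarith
  have hball : ∀ x, ‖x - x0‖ < k * ‖p‖ + 5 → x ∈ Ω := by
    intro x hx
    have hpre : IsPreconnected (Metric.ball x0 (k * ‖p‖ + 5)) :=
      (convex_ball _ _).isPreconnected
    by_contra hn
    have hcov : Metric.ball x0 (k * ‖p‖ + 5) ⊆ Ω ∪ (closure Ω)ᶜ := by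
      intro q hq
      by_contra hq2
      simp only [Set.mem_union, Set.mem_compl_iff, not_or, not_not] at hq2
      rw [Metric.mem_ball, dist_eq_norm, norm_sub_rev] at hq
      refine hnf q ?_ hq.le
      rw [hz.op.frontier_eq]
      exact ⟨hq2.2, hq2.1⟩
    have hxb : x ∈ Metric.ball x0 (k * ‖p‖ + 5) := by
      rw [Metric.mem_ball, dist_eq_norm]; exact hx
    obtain ⟨q, -, hq1, hq2⟩ := hpre Ω (closure Ω)ᶜ hz.op isClosed_closure.isOpen_compl hcov
      ⟨x0, Metric.mem_ball_self (by positivity), hx0Ω⟩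
      ⟨x, hxb, (hcov hxb).resolve_left hn⟩
    exact hq2 (hsub hq1)
  have hjp : ∀ j : ℕ, j ≤ k → ‖x0 - (x0 + (j : ℝ) • p)‖ ≤ k * ‖p‖ := by
    intro j hj
    have : x0 - (x0 + (j : ℝ) • p) = -((j : ℝ) • p) := by abel
    rw [this, norm_neg, norm_smul, Real.norm_natCast]
    have : (j : ℝ) ≤ k := by exact_mod_cast hj
    gcongr
  have hclaim : ∀ j : ℕ, j < k →
      S / 2 ≤ v (x0 + (j : ℝ) • p) (t0 - 1 - k * τ + j * τ) := by
    intro j hj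
    by_contra hlt
    push Not at hlt
    have hjk : (j : ℝ) ≤ k := by exact_mod_cast hj.le
    have hjτ : (j : ℝ) * τ ≤ k * τ := mul_le_mul_of_nonneg_right hjk hτ
    have hj0 : 0 ≤ (j : ℝ) * τ := by positivity
    have := H3 (x0 + (j : ℝ) • p) (t0 - 1 - k * τ + j * τ) x0 t0 hx0 (by linarith) (by linarith)
      (hjp j hj.le) (by
        intro x hx hxy
        have h := H2 x (t0 - 1 - k * τ + j * τ) (by
          intro w hw
          apply hball
          have e : w - x0 = (w - x) + (x - (x0 + (j : ℝ) • p)) + ((x0 + (j : ℝ) • p) - x0) := by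
            abel
          have h3 := hjp j hj.le
          rw [norm_sub_rev] at h3
          rw [e]
          refine (norm_add₃_le).trans_lt ?_
          linarith) (x0 + (j : ℝ) • p) (by linarith)
        have h4 : A * (‖x - (x0 + (j : ℝ) • p)‖ ^ 2) ^ (1/4 : ℝ) ≤ A * (ρ ^ 2) ^ (1/4 : ℝ) := by
          gcongr
        linarith)
    linarith
  have hcl : ∀ j : ℕ, x0 + (j : ℝ) • p ∈ closure Ω := by
    intro j
    induction j with
    | zero => simpa using hx0
    | succ n ih =>
      have := hpc _ ih
      convert this using 1
      push_cast
      rw [add_smul, one_smul, add_assoc]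
  have htel : ∀ n : ℕ, n ≤ k → n * (S / 2) ≤
      u (x0 + (n : ℝ) • p) (t0 - 1 - k * τ + n * τ) - u x0 (t0 - 1 - k * τ) := by
    intro n
    induction n with
    | zero => intro _; simp
    | succ n ih =>
      intro hn
      have h1 := ih (by omega)
      have h2 := hclaim n (by omega)
      rw [hv _ (hcl n)] at h2
      have e1 : x0 + ((n + 1 : ℕ) : ℝ) • p = x0 + (n : ℝ) • p + p := by
        push_cast
        rw [add_smul, one_smul, add_assoc]
      have e2 : t0 - 1 - k * τ + ((n + 1 : ℕ) : ℝ) * τ = t0 - 1 - k * τ + n * τ + τ := by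
        push_cast; ring
      rw [e1, e2]
      push_cast
      linarith
  have h1 := htel k le_rfl
  have h2 := abs_le.1 (hM _ (hcl k) (t0 - 1 - k * τ + k * τ))
  have h3 := abs_le.1 (hM x0 hx0 (t0 - 1 - k * τ))
  linarith [h2.2, h3.1]

lemma aux_pd_sub {N : ℕ} {φ ψ : EN N → ℝ} {x : EN N} (h1 : ContDiffAt ℝ 2 φ x)
    (h2 : ContDiffAt ℝ 2 ψ x) (i : Fin N) :
    pdE i (fun y => φ y - ψ y) x = pdE i φ x - pdE i ψ x := by
  unfold pdE
  rw [fderiv_fun_sub (h1.differentiableAt (by norm_num)) (h2.differentiableAt (by norm_num))]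
  rfl

lemma aux_pd_diff {N : ℕ} {φ : EN N → ℝ} {x : EN N} (h1 : ContDiffAt ℝ 2 φ x) (i : Fin N) :
    DifferentiableAt ℝ (fun y => pdE i φ y) x := by
  have h : ContDiffAt ℝ 1 (fderiv ℝ φ) x := h1.fderiv_right (by norm_num)
  exact (h.differentiableAt (by norm_num)).clm_apply (differentiableAt_const _)

lemma aux_pd2_sub {N : ℕ} {φ ψ : EN N → ℝ} {x : EN N} (h1 : ContDiffAt ℝ 2 φ x)
    (h2 : ContDiffAt ℝ 2 ψ x) (i j : Fin N) :
    pdE2 i j (fun y => φ y - ψ y) x = pdE2 i j φ x - pdE2 i j ψ x := by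
  have he : (fun y => pdE j (fun y => φ y - ψ y) y) =ᶠ[𝓝 x]
      fun y => pdE j φ y - pdE j ψ y := by
    filter_upwards [h1.eventually (by simp), h2.eventually (by simp)] with y hy1 hy2
    exact aux_pd_sub hy1 hy2 j
  unfold pdE2
  rw [pdE, he.fderiv_eq, fderiv_fun_sub (aux_pd_diff h1 j) (aux_pd_diff h2 j)]
  rfl

lemma aux_pd_shift {N : ℕ} (φ : EN N → ℝ) (p x : EN N) (i : Fin N) :
    pdE i (fun y => φ (y + p)) x = pdE i φ (x + p) := by
  unfold pdE
  rw [fderiv_comp_add_right]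

lemma aux_pd2_shift {N : ℕ} (φ : EN N → ℝ) (p x : EN N) (i j : Fin N) :
    pdE2 i j (fun y => φ (y + p)) x = pdE2 i j φ (x + p) := by
  unfold pdE2
  simp_rw [aux_pd_shift φ p]
  exact aux_pd_shift (fun y => pdE j φ y) p x i

lemma aux_shift_closure {N : ℕ} {Ω : Set (EN N)} (p : EN N) (hp : ∀ x, x ∈ Ω ↔ x + p ∈ Ω) :
    (∀ x ∈ closure Ω, x + p ∈ closure Ω) ∧ (∀ x ∈ frontier Ω, x + p ∈ frontier Ω) := by
  have e : (Homeomorph.addRight p) ⁻¹' Ω = Ω := by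
    ext x; exact (hp x).symm
  have h1 := (Homeomorph.addRight p).preimage_closure Ω
  have h2 := (Homeomorph.addRight p).preimage_frontier Ω
  rw [e] at h1 h2
  refine ⟨fun x hx => ?_, fun x hx => ?_⟩
  · rw [← h1] at hx; exact hx
  · rw [← h2] at hx; exact hx

lemma aux_zsol {N : ℕ} {Ω : Set (EN N)} {a : Fin N → Fin N → EN N → ℝ → ℝ}
    {b : Fin N → EN N → ℝ → ℝ} {c : EN N → ℝ → ℝ} {u1 u2 f g : EN N → ℝ → ℝ}
    (hop : IsOpen Ω) (h1 : IsSolDir Ω a b c f g u1) (h2 : IsSolDir Ω a b c f g u2) :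
    ZSol Ω a b c (fun x t => u1 x t - u2 x t) := by
  obtain ⟨⟨c1, d1, r1⟩, e1, b1⟩ := h1
  obtain ⟨⟨c2, d2, r2⟩, e2, b2⟩ := h2
  refine ⟨hop, c1.sub c2, fun x hx => (d1 x hx).sub (d2 x hx), fun t x hx => 
    (r1 t x hx).sub (r2 t x hx), ?_, ?_⟩
  · intro x hx t
    have E1 := e1 x hx t
    have E2 := e2 x hx t
    unfold parOpE at E1 E2 ⊢
    rw [deriv_fun_sub (d1 x hx t) (d2 x hx t)]
    simp_rw [aux_pd_sub (r1 t x hx) (r2 t x hx), aux_pd2_sub (r1 t x hx) (r2 t x hx), mul_sub,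
      Finset.sum_sub_distrib]
    linarith
  · intro x hx t
    show u1 x t - u2 x t = 0
    rw [b1 x hx, b2 x hx, sub_self]

lemma aux_sol_shift {N : ℕ} {Ω : Set (EN N)} {a : Fin N → Fin N → EN N → ℝ → ℝ}
    {b : Fin N → EN N → ℝ → ℝ} {c : EN N → ℝ → ℝ} {f g u : EN N → ℝ → ℝ}
    (p : EN N) (τ : ℝ) (hp : ∀ x, x ∈ Ω ↔ x + p ∈ Ω)
    (ha : ∀ i j, ∀ x ∈ Ω, ∀ t, a i j (x + p) (t + τ) = a i j x t)
    (hb : ∀ i, ∀ x ∈ Ω, ∀ t, b i (x + p) (t + τ) = b i x t)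
    (hc : ∀ x ∈ Ω, ∀ t, c (x + p) (t + τ) = c x t)
    (hf : ∀ x ∈ Ω, ∀ t, f (x + p) (t + τ) = f x t)
    (hg : ∀ x ∈ frontier Ω, ∀ t, g (x + p) (t + τ) = g x t)
    (h : IsSolDir Ω a b c f g u) :
    IsSolDir Ω a b c f g (fun x t => u (x + p) (t + τ)) := by
  obtain ⟨⟨c1, d1, r1⟩, e1, b1⟩ := h
  obtain ⟨hcl, hfr⟩ := aux_shift_closure p hp
  refine ⟨⟨?_, ?_, ?_⟩, ?_, ?_⟩
  · exact c1.comp (f := fun q : EN N × ℝ => (q.1 + p, q.2 + τ)) (by fun_prop)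
      (fun q hq => ⟨hcl _ hq.1, trivial⟩)
  · intro x hx
    exact (d1 (x + p) ((hp x).1 hx)).comp (f := fun s => s + τ) (by fun_prop)
  · intro t x hx
    exact (r1 (t + τ) (x + p) ((hp x).1 hx)).comp x (f := fun y => y + p) (by fun_prop)
  · intro x hx t
    have E1 := e1 (x + p) ((hp x).1 hx) (t + τ)
    rw [hf x hx] at E1
    unfold parOpE at E1 ⊢
    simp_rw [ha _ _ x hx, hb _ x hx, hc x hx] at E1
    rw [deriv_comp_add_const (f := fun s => u (x + p) s)]
    simp_rw [aux_pd_shift (fun y => u y (t + τ)) p, aux_pd2_shift (fun y => u y (t + τ)) p]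
    exact E1
  · intro x hx t
    show u (x + p) (t + τ) = g x t
    rw [b1 _ (hfr x hx), hg x hx]

lemma aux_final {N : ℕ} {Ω : Set (EN N)} {a : Fin N → Fin N → EN N → ℝ → ℝ}
    {b : Fin N → EN N → ℝ → ℝ} {c : EN N → ℝ → ℝ} {f g u : EN N → ℝ → ℝ}
    (hΩ : UniformlySmooth Ω) (hstd : StdCoeffsOn Ω a b c)
    (hc0 : ∀ x ∈ Ω, ∀ t : ℝ, c x t ≤ 0)
    (p : EN N) (τ : ℝ) (hτ : 0 ≤ τ) (hp : ∀ x, x ∈ Ω ↔ x + p ∈ Ω)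
    (ha : ∀ i j, ∀ x ∈ Ω, ∀ t, a i j (x + p) (t + τ) = a i j x t)
    (hb : ∀ i, ∀ x ∈ Ω, ∀ t, b i (x + p) (t + τ) = b i x t)
    (hc : ∀ x ∈ Ω, ∀ t, c (x + p) (t + τ) = c x t)
    (hf : ∀ x ∈ Ω, ∀ t, f (x + p) (t + τ) = f x t)
    (hg : ∀ x ∈ frontier Ω, ∀ t, g (x + p) (t + τ) = g x t)
    (h : IsSolDir Ω a b c f g u) (hbdd : BddOn (closure Ω) u) :
    ∀ x ∈ closure Ω, ∀ t, u (x + p) (t + τ) = u x t := by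
  obtain ⟨hop, r, hr, hball⟩ := hΩ
  obtain ⟨M, hM⟩ := hbdd
  have hs := aux_sol_shift p τ hp ha hb hc hf hg h
  have hcl := (aux_shift_closure p hp).1
  have z1 := aux_zsol hop hs h
  have z2 := aux_zsol hop h hs
  have k1 := aux_core u z1 hstd hc0 r hr (fun q hq => (hball q hq).2) p τ hτ M hM hcl
    (fun x _ t => rfl)
  have k2 := aux_core (fun x t => - u x t) z2 hstd hc0 r hr (fun q hq => (hball q hq).2) p τ hτ M
    (fun x hx t => by rw [abs_neg]; exact hM x hx t) hcl
    (fun x _ t => by ring)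
  intro x hx t
  have h1 := k1 x hx t
  have h2 := k2 x hx t
  linarith

/-- **Theorem 5.1.**  Let `Ω ⊆ ℝ^N` be a uniformly smooth domain and `u` a bounded
solution of the Dirichlet problem `P u = f` in `Ω × ℝ`, `u = g` on `∂Ω × ℝ`, where
`P`, `f`, `g` are periodic in the `m`-th variable with the same period `l` (and `Ω`
is periodic in the direction `x_m` if `m ≠ N + 1`), and `c ≤ 0`.  Then `u` is
periodic in the `m`-th variable with period `l`. -/
theorem thm_1per_dirichlet {N : ℕ} (Ω : Set (EN N))
    (a : Fin N → Fin N → EN N → ℝ → ℝ)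
    (b : Fin N → EN N → ℝ → ℝ) (c : EN N → ℝ → ℝ)
    (f g u : EN N → ℝ → ℝ) (m : Fin (N + 1)) (l : ℝ)
    (hl : 0 < l)
    (hΩ : UniformlySmooth Ω)
    (hΩper : ∀ h : (m : ℕ) < N, ∀ x : EN N,
      x ∈ Ω ↔ x + EuclideanSpace.single (⟨(m : ℕ), h⟩ : Fin N) l ∈ Ω)
    (hstd : StdCoeffsOn Ω a b c)
    (hc : ∀ x ∈ Ω, ∀ t : ℝ, c x t ≤ 0)
    (haper : ∀ i j, PerInVarS Ω m l (a i j))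
    (hbper : ∀ i, PerInVarS Ω m l (b i))
    (hcper : PerInVarS Ω m l c)
    (hfper : PerInVarS Ω m l f)
    (hgcont : ContinuousOn (fun p : EN N × ℝ => g p.1 p.2) (frontier Ω ×ˢ Set.univ))
    (hgper : PerInVarS (frontier Ω) m l g)
    (hsol : IsSolDir Ω a b c f g u)
    (hbdd : BddOn (closure Ω) u) :
    PerInVarS (closure Ω) m l u := by
  unfold PerInVarS at *
  by_cases h : (m : ℕ) < N
  · simp only [dif_pos h] at haper hbper hcper hfper hgper ⊢
    have := aux_final hΩ hstd hc (EuclideanSpace.single (⟨(m : ℕ), h⟩ : Fin N) l) 0 le_rfl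
      (hΩper h) (by simpa using haper) (by simpa using hbper) (by simpa using hcper)
      (by simpa using hfper) (by simpa using hgper) hsol hbdd
    simpa using this
  · simp only [dif_neg h] at haper hbper hcper hfper hgper ⊢
    have := aux_final hΩ hstd hc 0 l hl.le
      (fun x => by simp) (by simpa using haper) (by simpa using hbper) (by simpa using hcper)
      (by simpa using hfper) (by simpa using hgper) hsol hbdd
    simpa using this
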